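/- Let B be a unital C*-algebra, I a set, and for every ι ∈ I let A_ι and D_ι be unital C*-algebras containing copies of B as unital C*-subalgebras, with conditional expectations φ_ι : A_ι → B and ψ_ι : D_ι → B whose GNS representations are faithful. Suppose that for each ι ∈ I there is a unital completely positive map θ_ι : A_ι → D_ι that is also a B–B-bimodule map and satisfies ψ_ι∘θ_ι = φ_ι. Let (A,φ) = (*_B)_{ι∈I}(A_ι,φ_ι) and (D,ψ) = (*_B)_{ι∈I}(D_ι,ψ_ι) be the reduced amalgamated free products of C*-algebras. Then there is a unital completely positive map θ : A → D such that, for all ι ∈ I, the restriction of θ to the canonical copy of A_ι in A equals θ_ι followed by the canonical embedding D_ι ↪ D, and ψ∘θ = φ; moreover θ(a₁a₂⋯aₙ) = θ(a₁)θ(a₂)⋯θ(aₙ) whenever a_j ∈ A_{ι_j} ∩ ker φ_{ι_j} with ι₁ ≠ ι₂, ι₂ ≠ ι₃, …, ι_{n−1} ≠ ιₙ. -/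

import Mathlib

noncomputable section

/-- A conditional expectation from a unital C⋆-algebra `A` onto a unital C⋆-subalgebra
(the range of the unital embedding `j : B →⋆ₐ[ℂ] A`): a positive, `B`–`B`-bimodule,
idempotent (i.e. restricting to the identity on `B`) contraction. -/
structure IsCondExp {B A : Type*} [CStarAlgebra B] [CStarAlgebra A]
    (j : B →⋆ₐ[ℂ] A) (E : A →ₗ[ℂ] B) : Prop where
  injective : Function.Injective j
  left_inverse : ∀ b : B, E (j b) = b
  bimodule : ∀ (b₁ b₂ : B) (a : A), E (j b₁ * a * j b₂) = b₁ * E a * b₂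
  positive : ∀ a : A, ∃ b : B, E (star a * a) = star b * b
  contractive : ∀ a : A, ‖E a‖ ≤ ‖a‖

/-- The GNS representation of a conditional expectation `E : A → B` (i.e. the left action
of `A` on the Hilbert `B`-module `L²(A,E)` obtained from `A` by separation and completion
with respect to the `B`-valued inner product `⟨a₁, a₂⟩ = E (a₁⋆ * a₂)`) is faithful:
`a` acts as zero on the image of `A` in `L²(A,E)` only if `a = 0`. -/
def FaithfulGNS {B A : Type*} [CStarAlgebra B] [CStarAlgebra A] (E : A →ₗ[ℂ] B) : Prop :=
  ∀ a : A, (∀ x : A, E (star (a * x) * (a * x)) = 0) → a = 0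

/-- `(C, jC, emb, E)` is the reduced amalgamated free product of the unital C⋆-algebras
`A i` over `B` with respect to the conditional expectations `φ i : A i → B` (each having
faithful GNS representation): the `A i` embed into `C` compatibly with the copies of `B`,
`E` is a conditional expectation onto `B` with faithful GNS representation restricting to
`φ i` on each `A i`, the family of copies of the `A i` is free with respect to `E`, and
the copies of the `A i` together generate `C` as a C⋆-algebra.  These properties
characterize the reduced amalgamated free product `(A,φ) = (*_B)_{i ∈ I} (A i, φ i)`
up to canonical isomorphism. -/
structure IsReducedAmalgProd (B : Type*) [CStarAlgebra B] {I : Type*} {A : I → Type*}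
    [∀ i, CStarAlgebra (A i)] (jB : ∀ i, B →⋆ₐ[ℂ] A i) (φ : ∀ i, A i →ₗ[ℂ] B)
    {C : Type*} [CStarAlgebra C] (jC : B →⋆ₐ[ℂ] C) (emb : ∀ i, A i →⋆ₐ[ℂ] C)
    (E : C →ₗ[ℂ] B) : Prop where
  emb_injective : ∀ i, Function.Injective (emb i)
  compat : ∀ i, (emb i).comp (jB i) = jC
  condExp : IsCondExp jC E
  restrict : ∀ i (a : A i), E (emb i a) = φ i a
  faithful : FaithfulGNS E
  free : ∀ (n : ℕ) (ι : Fin (n + 1) → I), (∀ k : Fin n, ι k.castSucc ≠ ι k.succ) →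
    ∀ a : (j : Fin (n + 1)) → A (ι j), (∀ j, φ (ι j) (a j) = 0) →
      E ((List.ofFn fun j => emb (ι j) (a j)).prod) = 0
  generating :
    Dense ((StarAlgebra.adjoin ℂ (⋃ i, Set.range (emb i)) : StarSubalgebra ℂ C) : Set C)

/-- A completely positive map between unital C⋆-algebras. -/
def IsCompletelyPositive {A D : Type*} [CStarAlgebra A] [CStarAlgebra D]
    (θ : A →ₗ[ℂ] D) : Prop :=
  ∀ (n : ℕ) (a : Fin n → A) (c : Fin n → D),
    ∃ d : D, ∑ i, ∑ j, star (c i) * θ (star (a i) * a j) * c j = star d * d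

section

open scoped ComplexOrder InnerProductSpace

/-- A linear map which takes self-adjoint values on `star x * x` preserves the star operation. -/
lemma map_star_of_isSelfAdjoint {A D : Type*} [CStarAlgebra A] [CStarAlgebra D] {s : A →ₗ[ℂ] D}
    (hs : ∀ x, star (s (star x * x)) = s (star x * x)) (x : A) : s (star x) = star (s x) := by
  have h0 := hs 1
  have h1 := hs x
  have h2 := hs (1 + x)
  have h3 := hs (1 + Complex.I • x)
  simp only [star_add, star_one, star_smul, add_mul, mul_add, one_mul, mul_one, map_add, map_smul,
    smul_mul_assoc, mul_smul_comm, Complex.star_def, Complex.conj_I, star_neg, smul_smul, neg_mul,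
    Complex.I_mul_I, neg_neg, one_smul, neg_smul, map_neg, smul_neg, smul_add] at h0 h1 h2 h3
  rw [h0, h1] at h2 h3
  have h2' : star (s (star x)) + star (s x) = s (star x) + s x := by grind
  have h3' : Complex.I • (star (s (star x)) - star (s x)) = Complex.I • (s x - s (star x)) := by
    rw [smul_sub, smul_sub]
    grind
  have h3'' := smul_right_injective D Complex.I_ne_zero h3'
  have : (2 : ℂ) • s (star x) = (2 : ℂ) • star (s x) := by
    rw [two_smul, two_smul]
    grind
  exact smul_right_injective D two_ne_zero this

/-- A positive linear functional is hermitian. -/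
lemma positive_functional_star {A : Type*} [CStarAlgebra A] {s : A →ₗ[ℂ] ℂ}
    (hs : ∀ x, 0 ≤ s (star x * x)) (x : A) : s (star x) = star (s x) :=
  map_star_of_isSelfAdjoint (fun y => (IsSelfAdjoint.of_nonneg (hs y)).star_eq) x

/-- Positive functionals detect positivity of self-adjoint elements. -/
lemma exists_eq_star_mul_self_of_isSelfAdjoint {A : Type*} [CStarAlgebra A] {b : A}
    (hb : IsSelfAdjoint b)
    (h : ∀ s : A →L[ℂ] ℂ, (∀ x, 0 ≤ s (star x * x)) → 0 ≤ s b) : ∃ d, b = star d * d := by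
  let := CStarAlgebra.spectralOrder A
  have := CStarAlgebra.spectralOrderedRing A
  rw [← CStarAlgebra.nonneg_iff_eq_star_mul_self]
  by_contra hneg
  obtain ⟨f, hf, hfb⟩ := ProperCone.hyperplane_separation_point (x₀ := b) (ProperCone.positive ℝ A)
    (by simpa using hneg)
  let g : StrongDual ℝ A := f + f ∘L (starL' ℝ : A ≃L[ℝ] A).toContinuousLinearMap
  have hg (x : A) : g x = f x + f (star x) := rfl
  let s : A →L[ℂ] ℂ := StrongDual.extendRCLike g
  have hs (x : A) (hx : IsSelfAdjoint x) : s x = (2 * f x : ℝ) := by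
    have : g (Complex.I • x) = 0 := by
      rw [hg, star_smul, hx.star_eq]; simp
    simp only [s]
    rw [StrongDual.extendRCLike_apply]
    simp [this, hg, hx.star_eq]
    ring
  have h1 := h s fun x => by
    rw [hs _ (.star_mul_self x)]
    have := hf (star x * x) (by simp [star_mul_self_nonneg])
    exact_mod_cast by positivity
  rw [hs b hb] at h1
  have : 0 ≤ 2 * f b := by exact_mod_cast h1
  linarith

/-- Positive functionals separate points. -/
lemma eq_zero_of_functionals {A : Type*} [CStarAlgebra A] {b : A}
    (h : ∀ s : A →L[ℂ] ℂ, (∀ x, 0 ≤ s (star x * x)) → s (star b * b) = 0) : b = 0 := by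
  obtain ⟨d, hd⟩ := exists_eq_star_mul_self_of_isSelfAdjoint (b := -(star b * b))
    (IsSelfAdjoint.star_mul_self b).neg fun s hs => by simp [h s hs]
  let := CStarAlgebra.spectralOrder A
  have := CStarAlgebra.spectralOrderedRing A
  refine (CStarRing.star_mul_self_eq_zero_iff _).mp (le_antisymm ?_ (star_mul_self_nonneg b))
  rw [← neg_nonneg, hd]
  exact star_mul_self_nonneg d

/-- A separating family of positive functionals which is stable under conjugation detects
positivity. -/
lemma exists_eq_star_mul_self_of_family {A : Type*} [CStarAlgebra A] (S : Set (A →ₗ[ℂ] ℂ))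
    (hpos : ∀ s ∈ S, ∀ x, 0 ≤ s (star x * x))
    (hconj : ∀ s ∈ S, ∀ w, ∃ t ∈ S, ∀ x, t x = s (star w * x * w))
    (hsep : ∀ x, (∀ s ∈ S, s (star x * x) = 0) → x = 0) {T : A} (hT : ∀ s ∈ S, 0 ≤ s T) :
    ∃ d, T = star d * d := by
  let := CStarAlgebra.spectralOrder A
  have := CStarAlgebra.spectralOrderedRing A
  have hconjT (s) (hs : s ∈ S) (w : A) : 0 ≤ s (star w * T * w) := by
    obtain ⟨t, ht, h⟩ := hconj s hs w
    exact h T ▸ hT t ht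
  have hsa : IsSelfAdjoint T := by
    have hN (s) (hs : s ∈ S) (w : A) : s (star w * (T - star T) * w) = 0 := by
      have h1 := hconjT s hs w
      have h2 := positive_functional_star (hpos s hs) (star w * T * w)
      rw [star_mul, star_mul, star_star, ← mul_assoc] at h2
      rw [mul_sub, sub_mul, map_sub, h2, (IsSelfAdjoint.of_nonneg h1).star_eq, sub_self]
    have hNs : star (T - star T) = -(T - star T) := by simp
    set N := T - star T
    have : N = 0 := hsep N fun s hs => by
      have h1 := hN s hs (1 + Complex.I • N)
      have h2 := hN s hs (1 - Complex.I • N)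
      have h0 := hN s hs 1
      simp only [star_add, star_sub, star_one, star_smul, hNs, add_mul, mul_add, sub_mul, mul_sub,
        one_mul, mul_one, map_add, map_sub, map_smul, smul_mul_assoc, mul_smul_comm, smul_eq_mul,
        Complex.star_def, Complex.conj_I, neg_mul, mul_neg, map_neg, smul_neg] at h0 h1 h2 ⊢
      have : Complex.I * s (N * N) = 0 := by linear_combination (h1 - h2) / 4
      simpa using this
    exact (sub_eq_zero.mp this).symm
  have hn : T⁻ = 0 := by
    obtain ⟨e, he⟩ := CStarAlgebra.nonneg_iff_eq_star_mul_self.mp (CFC.negPart_nonneg T)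
    have hns : star T⁻ = T⁻ := (CFC.negPart_nonneg T).isSelfAdjoint.star_eq
    have hTn : T⁻ * T * T⁻ = -(T⁻ * T⁻ * T⁻) := by
      nth_rewrite 2 [← CFC.posPart_sub_negPart T hsa]
      rw [mul_sub, CFC.negPart_mul_posPart]
      simp
    have h : e * T⁻ = 0 := hsep _ fun s hs => by
      have h1 := hpos s hs (e * T⁻)
      have h2 := hconjT s hs T⁻
      have h3 : star (e * T⁻) * (e * T⁻) = T⁻ * T⁻ * T⁻ := by
        rw [star_mul, hns]
        nth_rewrite 4 [he]
        simp only [mul_assoc]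
      rw [hns, hTn, map_neg] at h2
      rw [h3] at h1 ⊢
      exact le_antisymm (by simpa using h2) h1
    have h2 : star T⁻ * T⁻ = 0 := by
      rw [hns]
      nth_rewrite 1 [he]
      rw [mul_assoc, h, mul_zero]
    exact CStarRing.star_mul_self_eq_zero_iff _ |>.mp h2
  rw [← CStarAlgebra.nonneg_iff_eq_star_mul_self, ← CFC.posPart_sub_negPart T hsa, hn, sub_zero]
  exact CFC.posPart_nonneg T

namespace IsCondExp

variable {B A : Type*} [CStarAlgebra B] [CStarAlgebra A] {j : B →⋆ₐ[ℂ] A} {E : A →ₗ[ℂ] B}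

lemma functional_nonneg (hE : IsCondExp j E) {s : B →L[ℂ] ℂ} (hs : ∀ x, 0 ≤ s (star x * x))
    (a : A) : 0 ≤ s (E (star a * a)) := by
  obtain ⟨b, hb⟩ := hE.positive a
  exact hb ▸ hs b

lemma map_star (hE : IsCondExp j E) (a : A) : E (star a) = star (E a) := by
  refine map_star_of_isSelfAdjoint (fun x => ?_) a
  obtain ⟨b, hb⟩ := hE.positive x
  simp [hb]

/-- Positivity in `A` is detected by the localised conditional expectation. -/
lemma exists_eq_star_mul_self (hE : IsCondExp j E) (hf : FaithfulGNS E) {T : A}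
    (hT : ∀ s : B →L[ℂ] ℂ, (∀ x, 0 ≤ s (star x * x)) → ∀ w, 0 ≤ s (E (star w * T * w))) :
    ∃ d, T = star d * d := by
  refine exists_eq_star_mul_self_of_family
    {t | ∃ s : B →L[ℂ] ℂ, (∀ x, 0 ≤ s (star x * x)) ∧ ∃ w, ∀ x, t x = s (E (star w * x * w))}
    ?_ ?_ ?_ ?_
  · rintro t ⟨s, hs, w, h⟩ x
    rw [h, show star w * (star x * x) * w = star (x * w) * (x * w) by simp [mul_assoc]]
    exact hE.functional_nonneg hs _
  · rintro t ⟨s, hs, w, h⟩ v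
    refine ⟨t ∘ₗ (LinearMap.mulLeft ℂ (star v)) ∘ₗ (LinearMap.mulRight ℂ v),
      ⟨s, hs, v * w, fun x => ?_⟩, fun x => ?_⟩
    · simp [h, mul_assoc]
    · simp [mul_assoc]
  · intro x hx
    refine hf x fun w => ?_
    obtain ⟨b, hb⟩ := hE.positive (x * w)
    have (s : B →L[ℂ] ℂ) (hs : ∀ x, 0 ≤ s (star x * x)) : s (star b * b) = 0 := by
      have := hx (s.toLinearMap ∘ₗ E ∘ₗ (LinearMap.mulLeft ℂ (star w)) ∘ₗ (LinearMap.mulRight ℂ w))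
        ⟨s, hs, w, fun x => by simp [mul_assoc]⟩
      rw [← hb]
      simpa [mul_assoc] using this
    rw [hb, eq_zero_of_functionals this, star_zero, zero_mul]
  · rintro t ⟨s, hs, w, h⟩
    exact h T ▸ hT s hs w

end IsCondExp

lemma IsCompletelyPositive.map_star {A D : Type*} [CStarAlgebra A] [CStarAlgebra D]
    {θ : A →ₗ[ℂ] D} (h : IsCompletelyPositive θ) (a : A) : θ (star a) = star (θ a) := by
  refine map_star_of_isSelfAdjoint (fun x => ?_) a
  obtain ⟨b, hb⟩ := h 1 (fun _ => x) (fun _ => 1)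
  simp only [Finset.univ_unique, Fin.default_eq_zero, Finset.sum_const, Finset.card_singleton,
    star_one, one_mul, mul_one, one_smul] at hb
  simp [hb]

lemma sum_sum_sum_rev {κ M : Type*} [Fintype κ] [AddCommMonoid M] (f : κ → κ → κ → M) :
    ∑ p, ∑ q, ∑ r, f p q r = ∑ r, ∑ q, ∑ p, f p q r :=
  (Finset.sum_congr rfl fun _ _ => Finset.sum_comm).trans
    (Finset.sum_comm.trans (Finset.sum_congr rfl fun _ _ => Finset.sum_comm))

/-- The matrix `θ (star (a p) * a q)` attached to a completely positive map is a Gram matrix. -/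
lemma IsCompletelyPositive.exists_gram {A D : Type*} [CStarAlgebra A] [CStarAlgebra D]
    {θ : A →ₗ[ℂ] D} (h : IsCompletelyPositive θ) {κ : Type*} [Fintype κ] (a : κ → A) :
    ∃ g : κ → κ → D, ∀ p q, θ (star (a p) * a q) = ∑ r, star (g r p) * g r q := by
  classical
  let := CStarAlgebra.spectralOrder D
  have := CStarAlgebra.spectralOrderedRing D
  let Q (s : D →L[ℂ] ℂ) (c : κ → D) : CStarMatrix κ κ D →ₗ[ℂ] ℂ :=
    { toFun T := s (∑ p, ∑ q, star (c p) * T p q * c q)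
      map_add' x y := by simp [mul_add, add_mul, Finset.sum_add_distrib]
      map_smul' t x := by simp [Finset.mul_sum] }
  have hQ (s : D →L[ℂ] ℂ) (c : κ → D) (T) : Q s c T = s (∑ p, ∑ q, star (c p) * T p q * c q) := rfl
  have hQ' (s : D →L[ℂ] ℂ) (c : κ → D) (T) : Q s c (star T * T) =
      ∑ r, s (star (∑ q, T r q * c q) * (∑ q, T r q * c q)) := by
    rw [hQ, ← map_sum]
    congr 1
    simp only [CStarMatrix.mul_apply, CStarMatrix.star_apply, star_sum, star_mul, Finset.sum_mul,
      Finset.mul_sum]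
    rw [sum_sum_sum_rev]
    simp only [mul_assoc]
  suffices h : ∃ g : CStarMatrix κ κ D,
      CStarMatrix.ofMatrix (Matrix.of fun p q => θ (star (a p) * a q)) = star g * g by
    obtain ⟨g, hg⟩ := h
    refine ⟨fun r q => g r q, fun p q => ?_⟩
    have := congrArg (fun M : CStarMatrix κ κ D => M p q) hg
    simpa [CStarMatrix.mul_apply, CStarMatrix.star_apply] using this
  refine exists_eq_star_mul_self_of_family
    {t | ∃ s : D →L[ℂ] ℂ, (∀ x, 0 ≤ s (star x * x)) ∧ ∃ c, t = Q s c} ?_ ?_ ?_ ?_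
  · rintro t ⟨s, hs, c, rfl⟩ x
    rw [hQ']
    exact Finset.sum_nonneg fun r _ => hs _
  · rintro t ⟨s, hs, c, rfl⟩ w
    refine ⟨_, ⟨s, hs, fun p => ∑ q, w p q * c q, rfl⟩, fun x => ?_⟩
    rw [hQ, hQ]
    congr 1
    simp only [CStarMatrix.mul_apply, CStarMatrix.star_apply, star_sum, star_mul, Finset.sum_mul,
      Finset.mul_sum]
    rw [Finset.sum_congr rfl fun p _ => sum_sum_sum_rev _, Finset.sum_comm]
    refine Finset.sum_congr rfl fun i _ => ?_
    rw [sum_sum_sum_rev]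
    simp only [mul_assoc]
    exact Finset.sum_comm

  · intro x hx
    have h0 : ∀ r q, x r q = 0 := fun r q => eq_zero_of_functionals fun s hs => by
      have := hx _ ⟨s, hs, Pi.single q 1, rfl⟩
      rw [hQ', Finset.sum_eq_zero_iff_of_nonneg fun r _ => hs _] at this
      simpa [Pi.single_apply] using this r
    ext r q
    exact h0 r q
  · rintro t ⟨s, hs, c, rfl⟩
    let e := (Fintype.equivFin κ).symm
    obtain ⟨d, hd⟩ := h _ (a ∘ e) (c ∘ e)
    rw [hQ]
    have : ∑ p, ∑ q, star (c p) * θ (star (a p) * a q) * c q = star d * d := by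
      rw [← hd, ← e.sum_comp]
      refine Finset.sum_congr rfl fun p _ => ?_
      rw [← e.sum_comp]
      rfl
    exact (congrArg s this).ge.trans' (hs d)

lemma IsCompletelyPositive.exists_gram_finset {A D : Type*} [CStarAlgebra A] [CStarAlgebra D]
    {θ : A →ₗ[ℂ] D} (h : IsCompletelyPositive θ) {X : Type*} (t : Finset X) (a : X → A) :
    ∃ g : X → X → D, ∀ p ∈ t, ∀ q ∈ t,
      θ (star (a p) * a q) = ∑ r ∈ t, star (g r p) * g r q := by
  classical
  obtain ⟨g, hg⟩ := h.exists_gram (fun p : t => a p)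
  refine ⟨fun r p => if h : r ∈ t ∧ p ∈ t then g ⟨r, h.1⟩ ⟨p, h.2⟩ else 0, fun p hp q hq => ?_⟩
  rw [hg ⟨p, hp⟩ ⟨q, hq⟩, ← Finset.sum_coe_sort t]
  exact Finset.sum_congr rfl fun r _ => by simp [hp, hq]

lemma exists_norm_sq_sub_eq_star_mul_self {A : Type*} [CStarAlgebra A] (a : A) :
    ∃ e : A, ((‖a‖ ^ 2 : ℝ) : ℂ) • (1 : A) - star a * a = star e * e := by
  let := CStarAlgebra.spectralOrder A
  have := CStarAlgebra.spectralOrderedRing A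
  rw [← CStarAlgebra.nonneg_iff_eq_star_mul_self, sub_nonneg]
  have := CStarAlgebra.star_mul_le_algebraMap_norm_sq (a := a)
  rwa [Algebra.algebraMap_eq_smul_one, ← Complex.coe_smul] at this

/-- A kernel with values in the linear functionals of a C⋆-algebra which is completely positive. -/
def IsPosKernel {X C : Type*} [CStarAlgebra C] (k : X → X → C →ₗ[ℂ] ℂ) : Prop :=
  ∀ (t : Finset X) (g : X → C), 0 ≤ ∑ x ∈ t, ∑ y ∈ t, k x y (star (g x) * g y)

namespace IsPosKernel

variable {X C : Type*} [CStarAlgebra C] {k : X → X → C →ₗ[ℂ] ℂ}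

/-- The pre-Hilbert space of a positive kernel. -/
def PreSpace (_ : IsPosKernel k) := X →₀ C

variable (h : IsPosKernel k)

instance : AddCommGroup h.PreSpace := inferInstanceAs (AddCommGroup (X →₀ C))
instance : Module ℂ h.PreSpace := inferInstanceAs (Module ℂ (X →₀ C))
instance : Module C h.PreSpace := inferInstanceAs (Module C (X →₀ C))
instance : SMulCommClass C ℂ h.PreSpace := inferInstanceAs (SMulCommClass C ℂ (X →₀ C))
instance : IsScalarTower ℂ C h.PreSpace := inferInstanceAs (IsScalarTower ℂ C (X →₀ C))

variable (k) in
/-- The sesquilinear form of a kernel. -/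
def form (f g : X →₀ C) : ℂ := f.sum fun x a => g.sum fun y b => k x y (star a * b)

lemma form_eq_sum (f g : X →₀ C) {t : Finset X} (hf : f.support ⊆ t) (hg : g.support ⊆ t) :
    form k f g = ∑ x ∈ t, ∑ y ∈ t, k x y (star (f x) * g y) := by
  rw [form, Finsupp.sum_of_support_subset _ hf _ (by simp)]
  refine Finset.sum_congr rfl fun x _ => ?_
  rw [Finsupp.sum_of_support_subset _ hg _ (by simp)]

lemma form_add_left (f f' g : X →₀ C) : form k (f + f') g = form k f g + form k f' g := by
  rw [form, Finsupp.sum_add_index' (by simp) (by simp [add_mul, Finsupp.sum_add])]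
  rfl

lemma form_add_right (f g g' : X →₀ C) : form k f (g + g') = form k f g + form k f g' := by
  simp only [form]
  rw [← Finsupp.sum_add]
  refine Finsupp.sum_congr fun x _ => ?_
  rw [Finsupp.sum_add_index' (by simp) (by simp [mul_add])]

lemma form_smul_right (r : ℂ) (f g : X →₀ C) : form k f (r • g) = r * form k f g := by
  simp only [form]
  rw [Finsupp.mul_sum]
  refine Finsupp.sum_congr fun x _ => ?_
  rw [Finsupp.sum_smul_index' (by simp), Finsupp.mul_sum]
  simp

lemma form_act (c : C) (f g : X →₀ C) : form k f (c • g) = form k (star c • f) g := by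
  simp only [form]
  rw [Finsupp.sum_smul_index' (by simp)]
  refine Finsupp.sum_congr fun x _ => ?_
  rw [Finsupp.sum_smul_index' (by simp)]
  simp [mul_assoc]

lemma form_single (x y : X) (a b : C) :
    form k (Finsupp.single x a) (Finsupp.single y b) = k x y (star a * b) := by
  simp [form]

include h in
lemma form_self_nonneg (f : X →₀ C) : 0 ≤ form k f f :=
  form_eq_sum f f subset_rfl subset_rfl ▸ h f.support f

lemma form_smul_left (r : ℂ) (f g : X →₀ C) : form k (r • f) g = star r * form k f g := by
  have := form_act (k := k) (star r • (1 : C)) f g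
  simpa [form_smul_right] using this.symm

include h in
lemma form_star (f g : X →₀ C) : star (form k f g) = form k g f := by
  have h0 := (Complex.nonneg_iff.mp (h.form_self_nonneg f)).2
  have h1 := (Complex.nonneg_iff.mp (h.form_self_nonneg g)).2
  have h2 := (Complex.nonneg_iff.mp (h.form_self_nonneg (f + g))).2
  have h3 := (Complex.nonneg_iff.mp (h.form_self_nonneg (f + Complex.I • g))).2
  simp only [form_add_left, form_add_right, form_smul_left, form_smul_right,
    Complex.add_im, Complex.star_def,
    Complex.conj_I, Complex.mul_im, Complex.mul_re, Complex.I_re, Complex.I_im, Complex.neg_re,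
    Complex.neg_im, Complex.add_re] at h0 h1 h2 h3
  apply Complex.ext
  · simp only [Complex.star_def, Complex.conj_re]; linarith
  · simp only [Complex.star_def, Complex.conj_im]; linarith

/-- The inner product of the pre-Hilbert space of a positive kernel. -/
abbrev core : PreInnerProductSpace.Core ℂ h.PreSpace where
  inner f g := form k f g
  conj_inner_symm f g := h.form_star g f
  re_inner_nonneg f := (Complex.nonneg_iff.mp (h.form_self_nonneg f)).1
  add_left f g g' := form_add_left f g g'
  smul_left f g r := form_smul_left r f g

instance : SeminormedAddCommGroup h.PreSpace :=
  InnerProductSpace.Core.toSeminormedAddCommGroup (c := h.core)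
instance : InnerProductSpace ℂ h.PreSpace := InnerProductSpace.ofCore h.core

lemma inner_def (f g : h.PreSpace) : ⟪f, g⟫_ℂ = form k f g := rfl

lemma inner_act (c : C) (f g : h.PreSpace) : ⟪f, c • g⟫_ℂ = ⟪star c • f, g⟫_ℂ := form_act c f g

lemma norm_act_le (c : C) (f : h.PreSpace) : ‖c • f‖ ≤ ‖c‖ * ‖f‖ := by
  obtain ⟨e, he⟩ := exists_norm_sq_sub_eq_star_mul_self c
  have h1 : ⟪e • f, e • f⟫_ℂ = ((‖c‖ ^ 2 : ℝ) : ℂ) * ⟪f, f⟫_ℂ - ⟪c • f, c • f⟫_ℂ := by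
    have h2 : ⟪(star e * e) • f, f⟫_ℂ = ⟪((‖c‖ ^ 2 : ℝ) : ℂ) • f - (star c * c) • f, f⟫_ℂ := by
      rw [← he, sub_smul, smul_assoc, one_smul]
    rw [inner_act, inner_act, smul_smul, smul_smul, h2, inner_sub_left, inner_smul_left,
      Complex.conj_ofReal]
  have hn (x : h.PreSpace) : ⟪x, x⟫_ℂ = ((‖x‖ ^ 2 : ℝ) : ℂ) := by
    rw [inner_self_eq_norm_sq_to_K]; norm_cast
  rw [hn, hn, hn] at h1
  have h2 : ‖e • f‖ ^ 2 = ‖c‖ ^ 2 * ‖f‖ ^ 2 - ‖c • f‖ ^ 2 := by exact_mod_cast h1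
  refine le_of_sq_le_sq ?_ (by positivity)
  nlinarith [sq_nonneg ‖e • f‖]

/-- The action of the C⋆-algebra on the pre-Hilbert space of a positive kernel. -/
def preRep (c : C) : h.PreSpace →L[ℂ] h.PreSpace :=
  LinearMap.mkContinuous
    { toFun f := c • f, map_add' := smul_add c, map_smul' r f := smul_comm c r f } ‖c‖
    (h.norm_act_le c)

lemma preRep_apply (c : C) (f : h.PreSpace) : h.preRep c f = c • f := rfl

/-- The Hilbert space of a positive kernel. -/
abbrev Space := UniformSpace.Completion h.PreSpace

open UniformSpace.Completion in
/-- The representation attached to a positive kernel. -/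
def rep : C →⋆ₐ[ℂ] (h.Space →L[ℂ] h.Space) where
  toFun c := (h.preRep c).completion
  map_one' := by
    ext b
    induction b using induction_on with
    | hp => apply isClosed_eq <;> fun_prop
    | ih b => simp [preRep_apply]
  map_zero' := by
    ext b
    induction b using induction_on with
    | hp => apply isClosed_eq <;> fun_prop
    | ih b => simp [preRep_apply, coe_zero]
  map_add' _ _ := by
    ext b
    induction b using induction_on with
    | hp => apply isClosed_eq <;> fun_prop
    | ih b => simp [preRep_apply, add_smul, coe_add]
  map_mul' _ _ := by
    ext b
    induction b using induction_on with
    | hp => apply isClosed_eq <;> fun_prop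
    | ih b => simp [preRep_apply, mul_smul]
  commutes' r := by
    ext b
    induction b using induction_on with
    | hp => apply isClosed_eq <;> fun_prop
    | ih b => simp [preRep_apply, Algebra.algebraMap_eq_smul_one]
  map_star' c := by
    refine (ContinuousLinearMap.eq_adjoint_iff _ _).mpr ?_
    intro x y
    induction x, y using induction_on₂ with
    | hp => apply isClosed_eq <;> fun_prop
    | ih x y => simp [preRep_apply, inner_act]

/-- The canonical vectors of the pre-Hilbert space of a positive kernel. -/
def preVec (x : X) (c : C) : h.PreSpace := Finsupp.single x c

lemma act_preVec (x : X) (c d : C) : d • h.preVec x c = h.preVec x (d * c) :=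
  Finsupp.smul_single d x c

/-- The canonical vectors of the Hilbert space of a positive kernel. -/
def vec (x : X) : h.Space := h.preVec x 1

lemma inner_vec_rep_vec (x y : X) (c : C) : ⟪h.vec x, h.rep c (h.vec y)⟫_ℂ = k x y c := by
  have : h.rep c (h.vec y) = ((c • h.preVec y 1 : h.PreSpace) : h.Space) :=
    ContinuousLinearMap.completion_apply_coe _ _
  rw [this, vec, UniformSpace.Completion.inner_coe, inner_def, act_preVec]
  exact (form_single x y _ _).trans (by simp)

end IsPosKernel

section Representation

variable {C H : Type*} [CStarAlgebra C] [NormedAddCommGroup H] [InnerProductSpace ℂ H]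
  [CompleteSpace H] (π : C →⋆ₐ[ℂ] (H →L[ℂ] H))

lemma inner_rep_star (a : C) (ξ η : H) : ⟪ξ, π (star a) η⟫_ℂ = ⟪π a ξ, η⟫_ℂ := by
  have h : π (star a) = ContinuousLinearMap.adjoint (π a) := π.map_star' a
  rw [h, ContinuousLinearMap.adjoint_inner_right]

lemma inner_rep_star_mul (a b : C) (ξ η : H) : ⟪ξ, π (star a * b) η⟫_ℂ = ⟪π a ξ, π b η⟫_ℂ := by
  rw [← inner_rep_star, map_mul]
  rfl

lemma norm_rep_apply_le (a : C) (ξ : H) : ‖π a ξ‖ ≤ ‖a‖ * ‖ξ‖ :=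
  (ContinuousLinearMap.le_opNorm _ _).trans
    (by gcongr; exact NonUnitalStarAlgHom.norm_apply_le _ a)

lemma continuous_rep_apply (ξ : H) : Continuous fun a => π a ξ :=
  AddMonoidHomClass.continuous_of_bound
    ({ toFun := fun a => π a ξ, map_zero' := by simp, map_add' := by simp } : C →+ H) ‖ξ‖
    fun a => (norm_rep_apply_le π a ξ).trans_eq (mul_comm _ _)

end Representation

namespace IsPosKernel

/-- Matrix coefficients of a representation form a positive kernel. -/
lemma of_rep {X C H : Type*} [CStarAlgebra C] [NormedAddCommGroup H] [InnerProductSpace ℂ H]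
    [CompleteSpace H] (π : C →⋆ₐ[ℂ] (H →L[ℂ] H)) (ξ : X → H) {k : X → X → C →ₗ[ℂ] ℂ}
    (hk : ∀ x y z, k x y z = ⟪ξ x, π z (ξ y)⟫_ℂ) : IsPosKernel k := by
  intro t g
  have : ∑ x ∈ t, ∑ y ∈ t, k x y (star (g x) * g y) =
      ⟪∑ x ∈ t, π (g x) (ξ x), ∑ x ∈ t, π (g x) (ξ x)⟫_ℂ := by
    rw [sum_inner]
    refine Finset.sum_congr rfl fun x _ => ?_
    rw [inner_sum]
    refine Finset.sum_congr rfl fun y _ => ?_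
    rw [hk, inner_rep_star_mul]
  rw [this, inner_self_eq_norm_sq_to_K]
  norm_cast
  exact Complex.zero_le_real.mpr (sq_nonneg _)

variable {X C : Type*} [CStarAlgebra C] {k : X → X → C →ₗ[ℂ] ℂ} (h : IsPosKernel k)
include h

protected lemma continuous (x y : X) : Continuous (k x y) := by
  have : (k x y : C → ℂ) = fun z => ⟪h.vec x, h.rep z (h.vec y)⟫_ℂ :=
    funext fun z => (h.inner_vec_rep_vec x y z).symm
  rw [this]
  exact continuous_const.inner (continuous_rep_apply h.rep _)

lemma norm_sq_le (x y : X) (z : C) : ‖k x y z‖ ^ 2 ≤ ‖z‖ ^ 2 * ((k x x 1).re * (k y y 1).re) := by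
  have hn (x : X) : (k x x 1).re = ‖h.vec x‖ ^ 2 := by
    rw [← h.inner_vec_rep_vec, map_one, one_apply_eq_self, inner_self_eq_norm_sq_to_K]
    norm_cast
  rw [hn, hn, ← mul_pow, ← mul_pow]
  gcongr
  rw [← h.inner_vec_rep_vec]
  refine (norm_inner_le_norm _ _).trans ?_
  rw [mul_left_comm]
  gcongr
  exact norm_rep_apply_le _ _ _

/-- Linear combinations of the vectors of a positive kernel form a positive kernel. -/
lemma exists_pullback {Y : Type*} (c : Y → X →₀ ℂ) : ∃ k' : Y → Y → C →ₗ[ℂ] ℂ, IsPosKernel k' ∧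
    ∀ y y' z, k' y y' z = (c y).sum fun x a => (c y').sum fun x' a' => star a * a' * k x x' z := by
  let ξ (y : Y) : h.Space := (c y).sum fun x a => a • h.vec x
  refine ⟨fun y y' => ∑ x ∈ (c y).support, ∑ x' ∈ (c y').support,
    (star (c y x) * c y' x') • k x x', of_rep h.rep ξ fun y y' z => ?_, fun y y' z => ?_⟩
  · simp only [ξ, Finsupp.sum, sum_inner, map_sum, inner_sum, map_smul, inner_smul_left,
      inner_smul_right, inner_vec_rep_vec, LinearMap.sum_apply, LinearMap.smul_apply, smul_eq_mul,
      Complex.star_def, Finset.mul_sum]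
    rw [Finset.sum_comm]
    exact Finset.sum_congr rfl fun _ _ => Finset.sum_congr rfl fun _ _ => by ring
  · simp [Finsupp.sum]

end IsPosKernel

/-- Linear functionals on `C × D` determined by matrix coefficients on a dense subspace extend to
a completely positive map. -/
theorem exists_isCompletelyPositive_extension {B C D X : Type*} [CStarAlgebra B] [CStarAlgebra C]
    [CStarAlgebra D] {j : B →⋆ₐ[ℂ] D} {E : D →ₗ[ℂ] B} (hE : IsCondExp j E)
    (hf : FaithfulGNS E) (v : X → D) (hv : Dense (Submodule.span ℂ (Set.range v) : Set D))
    (R : Submodule ℂ (C × D)) (hR : Dense (Prod.fst '' (R : Set (C × D)))) (h1 : (1, 1) ∈ R)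
    (hk : ∀ s : B →L[ℂ] ℂ, (∀ x, 0 ≤ s (star x * x)) → ∀ T : Finset X,
      ∃ k : X → X → C →ₗ[ℂ] ℂ, IsPosKernel k ∧ ∀ x ∈ T, ∀ x' ∈ T, ∀ p ∈ R,
        k x x' p.1 = s (E (star (v x) * p.2 * v x'))) :
    ∃ θ : C →ₗ[ℂ] D, IsCompletelyPositive θ ∧ (∀ p ∈ R, θ p.1 = p.2) ∧ ∀ z, ‖θ z‖ ≤ ‖z‖ := by
  classical
  have hEc : Continuous E := AddMonoidHomClass.continuous_of_bound E 1 (by simpa using hE.contractive)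
  have key (s : B →L[ℂ] ℂ) (hs : ∀ x, 0 ≤ s (star x * x)) (n : ℕ) (y : Fin n → D)
      (hy : ∀ i, y i ∈ Submodule.span ℂ (Set.range v)) :
      ∃ k : Fin n → Fin n → C →ₗ[ℂ] ℂ, IsPosKernel k ∧ ∀ i i', ∀ p ∈ R,
        k i i' p.1 = s (E (star (y i) * p.2 * y i')) := by
    have hy' (i) : ∃ c : X →₀ ℂ, (c.sum fun x a => a • v x) = y i :=
      Finsupp.mem_span_range_iff_exists_finsupp.mp (hy i)
    choose c hc using hy'
    obtain ⟨k, hk, hk'⟩ := hk s hs (Finset.univ.biUnion fun i => (c i).support)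
    obtain ⟨k', h', hk''⟩ := hk.exists_pullback c
    refine ⟨k', h', fun i i' p hp => ?_⟩
    rw [hk'', ← hc, ← hc]
    simp only [Finsupp.sum, star_sum, star_smul, Finset.sum_mul, Finset.mul_sum, map_sum,
      smul_mul_assoc, mul_smul_comm, map_smul, smul_eq_mul]
    rw [Finset.sum_comm]
    refine Finset.sum_congr rfl fun x hx => Finset.sum_congr rfl fun x' hx' => ?_
    rw [hk' _ (by simp; exact ⟨_, by simpa using hx'⟩) _ (by simp; exact ⟨_, by simpa using hx⟩) p hp]
    ring
  have hbound (p) (hp : p ∈ R) : ‖p.2‖ ≤ ‖p.1‖ := by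
    have h2 (s : B →L[ℂ] ℂ) (hs : ∀ x, 0 ≤ s (star x * x)) (y y' : D) :
        ‖s (E (star y * p.2 * y'))‖ ^ 2 ≤
          ‖p.1‖ ^ 2 * ((s (E (star y * 1 * y))).re * (s (E (star y' * 1 * y'))).re) := by
      have hcl : IsClosed {q : D × D | ‖s (E (star q.1 * p.2 * q.2))‖ ^ 2 ≤
          ‖p.1‖ ^ 2 * ((s (E (star q.1 * 1 * q.1))).re * (s (E (star q.2 * 1 * q.2))).re)} := by
        apply isClosed_le <;> fun_prop
      refine (hv.prod hv).induction (P := fun q : D × D => ‖s (E (star q.1 * p.2 * q.2))‖ ^ 2 ≤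
          ‖p.1‖ ^ 2 * ((s (E (star q.1 * 1 * q.1))).re * (s (E (star q.2 * 1 * q.2))).re))
          (fun q hq => ?_) hcl (y, y')
      obtain ⟨k, hk, hk'⟩ := key s hs 2 ![q.1, q.2] (by
        rw [Fin.forall_fin_two]; exact hq)
      have := hk.norm_sq_le 0 1 p.1
      rw [hk' _ _ p hp, hk' _ _ _ h1, hk' _ _ _ h1] at this
      exact this
    obtain ⟨e, he⟩ := hE.exists_eq_star_mul_self hf
      (T := ((‖p.1‖ ^ 2 : ℝ) : ℂ) • (1 : D) - star p.2 * p.2) fun s hs w => by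
        have h3 := h2 s hs (p.2 * w) w
        have hu := hE.functional_nonneg hs w
        have ht := hE.functional_nonneg hs (p.2 * w)
        have e1 : star (p.2 * w) * p.2 * w = star (p.2 * w) * (p.2 * w) := by rw [mul_assoc]
        rw [mul_one, mul_one, e1] at h3
        have e2 : s (E (star w * (((‖p.1‖ ^ 2 : ℝ) : ℂ) • (1 : D) - star p.2 * p.2) * w)) =
            ((‖p.1‖ ^ 2 : ℝ) : ℂ) * s (E (star w * w)) - s (E (star (p.2 * w) * (p.2 * w))) := by
          simp [mul_sub, sub_mul, mul_assoc]
        rw [e2]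
        have hre {z : ℂ} (hz : 0 ≤ z) : ∃ r : ℝ, 0 ≤ r ∧ z = r :=
          ⟨z.re, (Complex.nonneg_iff.mp hz).1,
            Complex.ext rfl (by simpa using (Complex.nonneg_iff.mp hz).2.symm)⟩
        obtain ⟨t, ht0, ht⟩ := hre ht
        obtain ⟨u, hu0, hu⟩ := hre hu
        rw [ht, hu] at h3 ⊢
        simp only [Complex.norm_real, Real.norm_eq_abs, sq_abs, Complex.ofReal_re] at h3
        have : t ≤ ‖p.1‖ ^ 2 * u := by
          rcases ht0.eq_or_lt with rfl | h
          · positivity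
          · nlinarith
        rw [← Complex.ofReal_mul, ← Complex.ofReal_sub]
        exact_mod_cast sub_nonneg.mpr this
    let := CStarAlgebra.spectralOrder D
    have := CStarAlgebra.spectralOrderedRing D
    have h4 : star p.2 * p.2 ≤ algebraMap ℝ D (‖p.1‖ ^ 2) := by
      rw [← sub_nonneg, Algebra.algebraMap_eq_smul_one, ← Complex.coe_smul, he]
      exact star_mul_self_nonneg e
    rw [← CStarAlgebra.norm_le_iff_le_algebraMap _ (by positivity) (star_mul_self_nonneg _),
      CStarRing.norm_star_mul_self, ← sq] at h4
    exact le_of_sq_le_sq h4 (by positivity)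
  let f : R →ₗ[ℂ] D := LinearMap.snd ℂ C D ∘ₗ R.subtype
  let e : R →ₗ[ℂ] C := LinearMap.fst ℂ C D ∘ₗ R.subtype
  have hd : DenseRange e := by
    have : Set.range e = Prod.fst '' (R : Set (C × D)) := by
      ext z
      simp [e]
    rwa [DenseRange, this]
  have hfe : ∀ p, ‖f p‖ ≤ 1 * ‖e p‖ := fun p => by simpa [f, e] using hbound p p.2
  let θ : C →L[ℂ] D := f.extendOfNorm e
  have hθ (p) (hp : p ∈ R) : θ p.1 = p.2 := LinearMap.extendOfNorm_eq hd ⟨1, hfe⟩ ⟨p, hp⟩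
  refine ⟨θ, fun n a c => ?_, hθ, fun z => ?_⟩
  · have pos (s : B →L[ℂ] ℂ) (hs : ∀ x, 0 ≤ s (star x * x)) (y : Fin n → D) :
        0 ≤ ∑ i, ∑ i', s (E (star (y i) * θ (star (a i) * a i') * y i')) := by
      have hd' : Dense {y : Fin n → D | ∀ i, y i ∈ Submodule.span ℂ (Set.range v)} := by
        have := dense_pi Set.univ fun (i : Fin n) _ => hv
        convert this using 1
        ext; simp [Set.mem_pi]
      refine hd'.induction (P := fun y : Fin n → D =>
        0 ≤ ∑ i, ∑ i', s (E (star (y i) * θ (star (a i) * a i') * y i'))) (fun y hy => ?_) ?_ y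
      · obtain ⟨k, hk, hk'⟩ := key s hs n y hy
        have hk'' (i i' z) : k i i' z = s (E (star (y i) * θ z * y i')) := by
          refine hR.induction (P := fun z => k i i' z = s (E (star (y i) * θ z * y i'))) ?_ ?_ z
          · rintro _ ⟨p, hp, rfl⟩
            rw [hk' _ _ p hp, hθ p hp]
          · have := hk.continuous i i'
            apply isClosed_eq <;> fun_prop
        simpa only [hk''] using hk Finset.univ a
      · apply isClosed_le <;> fun_prop
    refine hE.exists_eq_star_mul_self hf fun s hs w => ?_
    have := pos s hs fun i => c i * w
    simpa [Finset.mul_sum, Finset.sum_mul, mul_assoc] using this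
  · simpa using LinearMap.norm_extendOfNorm_apply_le hd 1 hfe z

/-- Families of vectors with the same Gram matrix are related by a partial isometry. -/
lemma exists_partialIsometry {Y F H : Type*} [NormedAddCommGroup F] [InnerProductSpace ℂ F]
    [CompleteSpace F] [NormedAddCommGroup H] [InnerProductSpace ℂ H] [CompleteSpace H]
    (e : Y → F) (g : Y → H) (heg : ∀ y y', ⟪e y, e y'⟫_ℂ = ⟪g y, g y'⟫_ℂ) :
    ∃ J : F →L[ℂ] H, (∀ v, ‖J v‖ ≤ ‖v‖) ∧ (∀ y, J (e y) = g y) ∧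
      (∀ v, (∀ y, ⟪e y, v⟫_ℂ = 0) → J v = 0) ∧
      ∀ ξ, ∀ τ ∈ (Submodule.span ℂ (Set.range e)).topologicalClosure,
        (∀ y, ⟪g y, ξ⟫_ℂ = ⟪e y, τ⟫_ℂ) → ∀ v, ⟪J v, ξ⟫_ℂ = ⟪v, τ⟫_ℂ := by
  set K := (Submodule.span ℂ (Set.range e)).topologicalClosure with hK
  have heK (y) : e y ∈ K := Submodule.le_topologicalClosure _ (Submodule.subset_span ⟨y, rfl⟩)
  let e' : (Y →₀ ℂ) →ₗ[ℂ] K := Finsupp.linearCombination ℂ fun y => ⟨e y, heK y⟩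
  let g' : (Y →₀ ℂ) →ₗ[ℂ] H := Finsupp.linearCombination ℂ g
  have he' (c) : (e' c : F) = Finsupp.linearCombination ℂ e c := by
    simp [e', Finsupp.linearCombination_apply, Finsupp.sum]
  have hd : DenseRange e' := by
    intro x
    rw [Topology.IsInducing.subtypeVal.closure_eq_preimage_closure_image, Set.mem_preimage]
    have : Subtype.val '' Set.range e' = (Submodule.span ℂ (Set.range e) : Set F) := by
      rw [← Finsupp.range_linearCombination]
      ext y
      simp [he']
    exact (congrArg closure this).ge x.2
  have hn (c) : ‖g' c‖ = ‖e' c‖ := by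
    have : ⟪g' c, g' c⟫_ℂ = ⟪(e' c : F), (e' c : F)⟫_ℂ := by
      rw [he']
      simp only [g', Finsupp.linearCombination_apply, Finsupp.sum, sum_inner, inner_sum,
        inner_smul_left, inner_smul_right, heg]
    rw [inner_self_eq_norm_sq_to_K, inner_self_eq_norm_sq_to_K] at this
    have h2 : ‖g' c‖ ^ 2 = ‖(e' c : F)‖ ^ 2 := by exact_mod_cast this
    exact (sq_eq_sq₀ (norm_nonneg _) (norm_nonneg _)).mp h2
  let U : K →L[ℂ] H := g'.extendOfNorm e'
  have hU (c) : U (e' c) = g' c := LinearMap.extendOfNorm_eq hd ⟨1, fun c => by simp [hn]⟩ c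
  refine ⟨U ∘L K.orthogonalProjectionOnto, fun v => ?_, fun y => ?_, fun v hv => ?_,
    fun ξ τ hτ h v => ?_⟩
  · refine (LinearMap.norm_extendOfNorm_apply_le hd 1 (fun c => by simp [hn]) _).trans ?_
    rw [one_mul]
    exact K.norm_orthogonalProjectionOnto_apply_le v
  · have := hU (Finsupp.single y 1)
    simp [e', g'] at this
    rw [← this]
    simp only [ContinuousLinearMap.comp_apply]
    congr 1
    exact Submodule.orthogonalProjectionOnto_mem_subspace_eq_self (⟨e y, heK y⟩ : K)
  · simp only [ContinuousLinearMap.comp_apply]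
    rw [(Submodule.orthogonalProjectionOnto_eq_zero_iff).mpr, map_zero]
    rw [hK, Submodule.orthogonal_closure, Submodule.mem_orthogonal]
    intro u hu
    induction hu using Submodule.span_induction with
    | mem x hx => obtain ⟨y, rfl⟩ := hx; exact hv y
    | zero => simp
    | add x y _ _ hx hy => rw [inner_add_left, hx, hy, add_zero]
    | smul a x _ hx => rw [inner_smul_left, hx, mul_zero]
  · have hx (x : K) : ⟪U x, ξ⟫_ℂ = ⟪(x : F), τ⟫_ℂ := by
      refine hd.induction_on (p := fun x : K => ⟪U x, ξ⟫_ℂ = ⟪(x : F), τ⟫_ℂ) x ?_ fun c => ?_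
      · apply isClosed_eq <;> fun_prop
      · rw [hU, he']
        simp only [g', Finsupp.linearCombination_apply, Finsupp.sum, sum_inner,
          inner_smul_left, h]
    simp only [ContinuousLinearMap.comp_apply]
    rw [hx]
    exact Submodule.inner_starProjection_left_eq_right K v τ |>.trans (by
      rw [Submodule.starProjection_eq_self_iff.mpr hτ])

/-- The partial isometry intertwines representations if the families of vectors are compatible. -/
lemma partialIsometry_intertwines {Y F H C : Type*} [CStarAlgebra C] [NormedAddCommGroup F]
    [InnerProductSpace ℂ F]
    [CompleteSpace F] [NormedAddCommGroup H] [InnerProductSpace ℂ H] [CompleteSpace H]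
    {e : Y → F} {g : Y → H} {J : F →L[ℂ] H} (h1 : ∀ y, J (e y) = g y)
    (h2 : ∀ v, (∀ y, ⟪e y, v⟫_ℂ = 0) → J v = 0)
    {ρ : C →⋆ₐ[ℂ] (F →L[ℂ] F)} {π : C →⋆ₐ[ℂ] (H →L[ℂ] H)}
    (hρ : ∀ a y, ∃ y', ρ a (e y) = e y' ∧ π a (g y) = g y') (a : C) (v : F) :
    J (ρ a v) = π a (J v) := by
  set K := (Submodule.span ℂ (Set.range e)).topologicalClosure with hK
  have heK (y) : e y ∈ K := Submodule.le_topologicalClosure _ (Submodule.subset_span ⟨y, rfl⟩)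
  have hp (x : F) (hx : x ∈ K) : J (ρ a x) = π a (J x) := by
    have hcl : IsClosed {x | J (ρ a x) = π a (J x)} := by
      apply isClosed_eq <;> fun_prop
    refine closure_minimal (s := (Submodule.span ℂ (Set.range e) : Set F)) (fun x hx => ?_) hcl hx
    induction hx using Submodule.span_induction with
    | mem x hx =>
      obtain ⟨y, rfl⟩ := hx
      obtain ⟨y', h, h'⟩ := hρ a y
      rw [Set.mem_ofPred_eq, h, h1, h1, h']
    | zero => simp
    | add x y _ _ hx hy => simp_all
    | smul a x _ hx => simp_all
  obtain ⟨x, hx, z, hz, rfl⟩ := K.exists_add_mem_mem_orthogonal v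
  have hz' (y) : ⟪e y, z⟫_ℂ = 0 := hz _ (heK y)
  have h3 : J (ρ a z) = 0 := h2 _ fun y => by
    obtain ⟨y', h, -⟩ := hρ (star a) y
    rw [← star_star a, inner_rep_star, h, hz']
  simp [hp x hx, h3, h2 z hz']

/-- Alternating words: products of letters of pairwise distinct neighbouring colours, followed by
an element of the base. The parameters are the number of letters and the colour of the first. -/
inductive AltWord {I M : Type*} [Mul M] (base : Set M) (letter : I → Set M) :
    ℕ → Option I → M → Prop
  | base {b : M} (hb : b ∈ base) : AltWord base letter 0 none b
  | cons {i : I} {l y : M} {n : ℕ} {o : Option I} (hl : l ∈ letter i)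
      (hy : AltWord base letter n o y) (ho : o ≠ some i) : AltWord base letter (n + 1) (some i) (l * y)

/-- Compatibility of letters with the base and the star operation. -/
structure IsLetterSystem {I M : Type*} [Monoid M] [StarMul M] (base : Set M)
    (letter : I → Set M) : Prop where
  one_mem : 1 ∈ base
  mul_mem : ∀ {b b'}, b ∈ base → b' ∈ base → b * b' ∈ base
  star_mem : ∀ {b}, b ∈ base → star b ∈ base
  base_mul_letter : ∀ {i b l}, b ∈ base → l ∈ letter i → b * l ∈ letter i
  letter_mul_base : ∀ {i b l}, b ∈ base → l ∈ letter i → l * b ∈ letter i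
  star_letter : ∀ {i l}, l ∈ letter i → star l ∈ letter i

namespace AltWord

variable {I M : Type*}

lemma eq_zero_iff [Mul M] {base : Set M} {letter : I → Set M} {n : ℕ} {o : Option I} {y : M}
    (h : AltWord base letter n o y) : n = 0 ↔ o = none := by
  cases h <;> simp

lemma map [Mul M] {N : Type*} [Mul N] (f : M →ₙ* N) {base : Set M} {letter : I → Set M}
    {base' : Set N} {letter' : I → Set N} (hb : ∀ b ∈ base, f b ∈ base')
    (hl : ∀ i, ∀ l ∈ letter i, f l ∈ letter' i) {n : ℕ} {o : Option I} {y : M}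
    (h : AltWord base letter n o y) : AltWord base' letter' n o (f y) := by
  induction h with
  | base h => exact .base (hb _ h)
  | cons h _ ho ih => rw [map_mul]; exact .cons (hl _ _ h) ih ho

lemma lift [Mul M] {N : Type*} [Mul N] (f : M →ₙ* N) {base : Set M} {letter : I → Set M}
    {base' : Set N} {letter' : I → Set N} (hb : ∀ b ∈ base', ∃ c ∈ base, f c = b)
    (hl : ∀ i, ∀ l ∈ letter' i, ∃ l' ∈ letter i, f l' = l) {n : ℕ} {o : Option I} {y : N}
    (h : AltWord base' letter' n o y) : ∃ x, AltWord base letter n o x ∧ f x = y := by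
  induction h with
  | base h => obtain ⟨c, hc, rfl⟩ := hb _ h; exact ⟨c, .base hc, rfl⟩
  | cons h _ ho ih =>
    obtain ⟨l, hl, rfl⟩ := hl _ _ h
    obtain ⟨x, hx, rfl⟩ := ih
    exact ⟨_, .cons hl hx ho, map_mul ..⟩

variable [Monoid M] [StarMul M] {base : Set M} {letter : I → Set M}
  (hL : IsLetterSystem base letter) {n m : ℕ} {o o' : Option I} {u x y b : M}
include hL

lemma base_mul (h : AltWord base letter n o y) (hb : b ∈ base) :
    AltWord base letter n o (b * y) := by
  cases h with
  | base h => exact .base (hL.mul_mem hb h)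
  | cons h hy ho => rw [← mul_assoc]; exact .cons (hL.base_mul_letter hb h) hy ho

lemma mul_base (h : AltWord base letter n o y) (hb : b ∈ base) :
    AltWord base letter n o (y * b) := by
  induction h with
  | base h => exact .base (hL.mul_mem h hb)
  | cons h hy ho ih => rw [mul_assoc]; exact .cons h ih ho

lemma star_mul (hu : AltWord base letter n o u) (hx : AltWord base letter m o' x)
    (h : ∀ i, o = some i → o' ≠ some i) : ∃ o'', AltWord base letter (n + m) o'' (star u * x) := by
  induction hu generalizing m o' x with
  | base hb => exact ⟨o', by simpa using hx.base_mul hL (hL.star_mem hb)⟩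
  | @cons i l y n o hl hy ho ih =>
    obtain ⟨o'', h''⟩ := ih (.cons (hL.star_letter hl) hx (h i rfl)) fun j hj hij => ho (hj.trans hij.symm)
    exact ⟨o'', by rwa [star_mul, mul_assoc, add_right_comm, add_assoc]⟩

lemma star (hu : AltWord base letter n o u) : ∃ o', AltWord base letter n o' (star u) := by
  simpa using hu.star_mul hL (.base hL.one_mem) (by simp)

end AltWord

/-- The words in a reduced amalgamated free product. -/
abbrev AmalgWord {B : Type*} [CStarAlgebra B] {I : Type*} {A : I → Type*}
    [∀ i, CStarAlgebra (A i)] (φ : ∀ i, A i →ₗ[ℂ] B)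
    {C : Type*} [CStarAlgebra C] (jC : B →⋆ₐ[ℂ] C) (emb : ∀ i, A i →⋆ₐ[ℂ] C) :
    ℕ → Option I → C → Prop :=
  AltWord (Set.range jC) fun i => emb i '' {a | φ i a = 0}

section AmalgWord

variable {B : Type*} [CStarAlgebra B] {I : Type*} {A : I → Type*}
    [∀ i, CStarAlgebra (A i)] {jB : ∀ i, B →⋆ₐ[ℂ] A i} {φ : ∀ i, A i →ₗ[ℂ] B}
    {C : Type*} [CStarAlgebra C] {jC : B →⋆ₐ[ℂ] C} {emb : ∀ i, A i →⋆ₐ[ℂ] C}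
    {E : C →ₗ[ℂ] B}

namespace IsCondExp

variable {A : Type*} [CStarAlgebra A] {j : B →⋆ₐ[ℂ] A} {E : A →ₗ[ℂ] B} (h : IsCondExp j E)
include h

lemma map_left (b : B) (a : A) : E (j b * a) = b * E a := by simpa using h.bimodule b 1 a

lemma map_right (b : B) (a : A) : E (a * j b) = E a * b := by simpa using h.bimodule 1 b a

lemma centered (a : A) : E (a - j (E a)) = 0 := by simp [h.left_inverse]

end IsCondExp

lemma isLetterSystem_amalg (hφ : ∀ i, IsCondExp (jB i) (φ i))
    (h : IsReducedAmalgProd B jB φ jC emb E) :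
    IsLetterSystem (Set.range jC) (fun i => emb i '' {a | φ i a = 0}) where
  one_mem := ⟨1, map_one _⟩
  mul_mem := by rintro _ _ ⟨b, rfl⟩ ⟨b', rfl⟩; exact ⟨b * b', map_mul ..⟩
  star_mem := by rintro _ ⟨b, rfl⟩; exact ⟨_, map_star ..⟩
  base_mul_letter := by
    rintro i _ _ ⟨b, rfl⟩ ⟨a, ha, rfl⟩
    refine ⟨jB i b * a, ?_, ?_⟩
    · simp_all [(hφ i).map_left]
    · simp [← h.compat i]
  letter_mul_base := by
    rintro i _ _ ⟨b, rfl⟩ ⟨a, ha, rfl⟩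
    refine ⟨a * jB i b, ?_, ?_⟩
    · simp_all [(hφ i).map_right]
    · simp [← h.compat i]
  star_letter := by
    rintro i _ ⟨a, ha, rfl⟩
    refine ⟨star a, ?_, map_star ..⟩
    simp_all [(hφ i).map_star]

namespace IsReducedAmalgProd

variable (h : IsReducedAmalgProd B jB φ jC emb E)
include h

lemma emb_base (i : I) (b : B) : emb i (jB i b) = jC b := by simp [← h.compat i]

lemma exists_ofFn (hφ : ∀ i, IsCondExp (jB i) (φ i)) {n : ℕ} {o : Option I} {y : C}
    (hy : AmalgWord φ jC emb n o y) {m : ℕ} (hm : n = m + 1) :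
    ∃ (ι : Fin (m + 1) → I), (∀ k : Fin m, ι k.castSucc ≠ ι k.succ) ∧
    ∃ a : (j : Fin (m + 1)) → A (ι j), (∀ j, φ (ι j) (a j) = 0) ∧
      y = (List.ofFn fun j => emb (ι j) (a j)).prod ∧ o = some (ι 0) := by
  induction hy generalizing m with
  | base => simp at hm
  | @cons i l y n o hl hy ho ih =>
    obtain rfl : n = m := by simpa using hm
    cases hy with
    | base hb =>
      obtain ⟨a, ha, rfl⟩ := hl
      obtain ⟨b, rfl⟩ := hb
      refine ⟨fun _ => i, by simp, fun _ => a * jB i b, fun _ => ?_, ?_, rfl⟩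
      · rw [(hφ i).map_right, show φ i a = 0 from ha, zero_mul]
      · simp [h.emb_base]
    | @cons i' l' y' n' o' hl' hy' ho' =>
      obtain ⟨a, ha, rfl⟩ := hl
      obtain ⟨ι, hι, c, hc, he, hs⟩ := ih rfl
      refine ⟨Fin.cons i ι, fun k => ?_,
        fun j => Fin.cases (motive := fun j => A ((Fin.cons i ι : Fin (n' + 2) → I) j)) a c j,
        fun j => ?_, ?_, rfl⟩
      · refine Fin.cases ?_ (fun k => ?_) k
        · rw [hs] at ho
          simpa [eq_comm] using ho
        · simpa using hι k
      · refine Fin.cases ha hc j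
      · rw [he, List.ofFn_succ (n := n' + 1), List.prod_cons]
        rfl

lemma condExp_word (hφ : ∀ i, IsCondExp (jB i) (φ i)) {n : ℕ} {o : Option I} {y : C}
    (hy : AmalgWord φ jC emb n o y) (hn : n ≠ 0) : E y = 0 := by
  obtain ⟨m, rfl⟩ := Nat.exists_eq_succ_of_ne_zero hn
  obtain ⟨ι, hι, a, ha, rfl, -⟩ := h.exists_ofFn hφ hy rfl
  exact h.free m ι hι a ha

lemma condExp_star_mul_emb_mul (hφ : ∀ i, IsCondExp (jB i) (φ i)) {n m : ℕ} {o o' : Option I}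
    {u x : C} (hu : AmalgWord φ jC emb n o u) (hx : AmalgWord φ jC emb m o' x) {i : I}
    (ho : o ≠ some i) (ho' : o' ≠ some i) (e : A i) :
    E (star u * (emb i e * x)) = E (star u * (jC (φ i e) * x)) := by
  have h1 : AmalgWord φ jC emb (m + 1) (some i) (emb i (e - jB i (φ i e)) * x) :=
    .cons ⟨_, (hφ i).centered e, rfl⟩ hx ho'
  obtain ⟨o'', h2⟩ := hu.star_mul (isLetterSystem_amalg hφ h) h1 fun j hj hij => ho (hj.trans hij.symm)
  have h3 := h.condExp_word hφ h2 (by simp)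
  rw [map_sub, h.emb_base, sub_mul, mul_sub, map_sub] at h3
  exact sub_eq_zero.mp h3

lemma condExp_star_mul_of_length_ne (hφ : ∀ i, IsCondExp (jB i) (φ i)) {n m : ℕ}
    {o o' : Option I} {u x : C} (hu : AmalgWord φ jC emb n o u) (hx : AmalgWord φ jC emb m o' x)
    (hnm : n ≠ m) : E (star u * x) = 0 := by
  have hL := isLetterSystem_amalg hφ h
  induction hu generalizing m o' x with
  | base hb => exact h.condExp_word hφ (hx.base_mul hL (hL.star_mem hb)) (Ne.symm hnm)
  | @cons i l u n o hl hu ho ih =>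
    have hlu : AmalgWord φ jC emb (n + 1) (some i) (l * u) := .cons hl hu ho
    cases hx with
    | base hb =>
      obtain ⟨o'', h''⟩ := hlu.star hL
      exact h.condExp_word hφ (h''.mul_base hL hb) (by simp)
    | @cons i' l' x m o' hl' hx ho' =>
      by_cases hi : i = i'
      · subst hi
        obtain ⟨a, ha, rfl⟩ := hl
        obtain ⟨a', ha', rfl⟩ := hl'
        have := h.condExp_star_mul_emb_mul hφ hu hx ho ho' (star a * a')
        rw [ih (hx.base_mul hL ⟨_, rfl⟩) (by simpa using hnm)] at this
        rw [← this, map_mul (emb i), StarHomClass.map_star (emb i), star_mul]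
        simp only [mul_assoc]
      · have hlx : AmalgWord φ jC emb (m + 1) (some i') (l' * x) := .cons hl' hx ho'
        obtain ⟨o'', h''⟩ := hlu.star_mul hL hlx
          fun j hj hj' => hi ((Option.some.inj hj).trans (Option.some.inj hj').symm)
        exact h.condExp_word hφ h'' (by simp)

end IsReducedAmalgProd

/-- The span of the words which start with `j` or have fewer than `p` letters. -/
def wordSpan (φ : ∀ i, A i →ₗ[ℂ] B) (jC : B →⋆ₐ[ℂ] C) (emb : ∀ i, A i →⋆ₐ[ℂ] C)
    (j : I) (p : ℕ) : Submodule ℂ C :=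
  Submodule.span ℂ {y | ∃ q o, AmalgWord φ jC emb q o y ∧ (o = some j ∨ q < p)}

namespace IsReducedAmalgProd

variable (h : IsReducedAmalgProd B jB φ jC emb E)
include h

lemma letter_mul_mem_wordSpan (hφ : ∀ i, IsCondExp (jB i) (φ i)) {j : I} {a : A j} (ha : φ j a = 0)
    {p : ℕ} {o : Option I} {x : C} (hx : AmalgWord φ jC emb p o x) :
    emb j a * x ∈ wordSpan φ jC emb j p := by
  by_cases ho : o = some j
  · cases hx with
    | base => simp at ho
    | @cons i l x n o hl hx ho' =>
      obtain rfl : i = j := by simpa using ho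
      obtain ⟨a', ha', rfl⟩ := hl
      have : emb i a * (emb i a' * x) = emb i (a * a' - jB i (φ i (a * a'))) * x
          + jC (φ i (a * a')) * x := by
        simp [sub_mul, h.emb_base, mul_assoc]
      rw [this]
      refine add_mem (Submodule.subset_span ⟨_, _, .cons ⟨_, (hφ i).centered _, rfl⟩ hx ho', .inl rfl⟩)
        (Submodule.subset_span ⟨_, _, hx.base_mul (isLetterSystem_amalg hφ h) ⟨_, rfl⟩,
          .inr (Nat.lt_succ_self _)⟩)
  · exact Submodule.subset_span ⟨_, _, .cons ⟨a, ha, rfl⟩ hx ho, .inl rfl⟩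

lemma word_mul_mem_wordSpan (hφ : ∀ i, IsCondExp (jB i) (φ i)) {n : ℕ} {o : Option I} {ζ : C}
    (hζ : AmalgWord φ jC emb n o ζ) {j : I} (hj : o = some j) {p : ℕ} {o' : Option I} {x : C}
    (hx : AmalgWord φ jC emb p o' x) : ζ * x ∈ wordSpan φ jC emb j p := by
  induction hζ generalizing j with
  | base => simp at hj
  | @cons i l ζ n o hl hζ ho ih =>
    obtain rfl : i = j := by simpa using hj
    obtain ⟨a, ha, rfl⟩ := hl
    cases o with
    | none =>
      cases hζ with
      | base hb =>
        rw [mul_assoc]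
        exact h.letter_mul_mem_wordSpan hφ ha (hx.base_mul (isLetterSystem_amalg hφ h) hb)
    | some j' =>
      have h1 := ih rfl
      rw [mul_assoc]
      have : wordSpan φ jC emb j' p ≤ (wordSpan φ jC emb i p).comap (LinearMap.mulLeft ℂ (emb i a)) := by
        refine Submodule.span_le.mpr ?_
        rintro y ⟨q, o, hy, ho' | hq⟩
        · exact Submodule.subset_span ⟨_, _, .cons ⟨a, ha, rfl⟩ hy (ho' ▸ ho), .inl rfl⟩
        · have := h.letter_mul_mem_wordSpan hφ ha hy
          refine Submodule.span_mono ?_ this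
          rintro y ⟨q', o, hy, ho'⟩
          exact ⟨q', o, hy, ho'.imp_right fun h => h.trans hq⟩
      exact this h1

lemma dense_span_words (hφ : ∀ i, IsCondExp (jB i) (φ i)) :
    Dense (Submodule.span ℂ {y | ∃ n o, AmalgWord φ jC emb n o y} : Set C) := by
  have hL := isLetterSystem_amalg hφ h
  set S := Submodule.span ℂ {y | ∃ n o, AmalgWord φ jC emb n o y} with hS
  have emb_mul (i) (a : A i) {z : C} (hz : z ∈ S) : emb i a * z ∈ S := by
    have : S ≤ S.comap (LinearMap.mulLeft ℂ (emb i a)) := by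
      refine Submodule.span_le.mpr ?_
      rintro y ⟨n, o, hy⟩
      have e : emb i a * y = emb i (a - jB i (φ i a)) * y + jC (φ i a) * y := by
        simp [sub_mul, h.emb_base]
      change emb i a * y ∈ S
      rw [e]
      refine add_mem (Submodule.span_mono ?_ (h.letter_mul_mem_wordSpan hφ ((hφ i).centered a) hy))
        (Submodule.subset_span ⟨_, _, hy.base_mul hL ⟨_, rfl⟩⟩)
      rintro y ⟨n, o, hy, -⟩
      exact ⟨n, o, hy⟩
    exact this hz
  refine h.generating.mono fun c hc => ?_
  have key : (∀ z ∈ S, c * z ∈ S) ∧ ∀ z ∈ S, star c * z ∈ S := by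
    induction hc using StarAlgebra.adjoin_induction with
    | mem x hx =>
      obtain ⟨i, a, rfl⟩ := Set.mem_iUnion.mp hx
      exact ⟨fun z hz => emb_mul i a hz, fun z hz => map_star (emb i) a ▸ emb_mul i _ hz⟩
    | algebraMap r =>
      simp only [Algebra.algebraMap_eq_smul_one, star_smul, star_one, smul_mul_assoc, one_mul]
      exact ⟨fun z hz => S.smul_mem _ hz, fun z hz => S.smul_mem _ hz⟩
    | add x y _ _ hx hy =>
      simp only [star_add, add_mul]
      exact ⟨fun z hz => add_mem (hx.1 z hz) (hy.1 z hz), fun z hz => add_mem (hx.2 z hz) (hy.2 z hz)⟩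
    | mul x y _ _ hx hy =>
      simp only [star_mul, mul_assoc]
      exact ⟨fun z hz => hx.1 _ (hy.1 z hz), fun z hz => hy.2 _ (hx.2 z hz)⟩
    | star x _ hx => exact ⟨hx.2, by simpa using hx.1⟩
  simpa using key.1 1 (Submodule.subset_span ⟨_, _, .base hL.one_mem⟩)

end IsReducedAmalgProd

end AmalgWord

section LetterExpectation

variable {B : Type*} [CStarAlgebra B] {I : Type*} {A : I → Type*}
    [∀ i, CStarAlgebra (A i)] {jB : ∀ i, B →⋆ₐ[ℂ] A i} {φ : ∀ i, A i →ₗ[ℂ] B}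
    {C : Type*} [CStarAlgebra C] {jC : B →⋆ₐ[ℂ] C} {emb : ∀ i, A i →⋆ₐ[ℂ] C}
    {E : C →ₗ[ℂ] B}

lemma IsCondExp.isPosKernel {j : B →⋆ₐ[ℂ] C} {E : C →ₗ[ℂ] B} (hE : IsCondExp j E) {s : B →ₗ[ℂ] ℂ}
    (hs : ∀ x, 0 ≤ s (star x * x)) {X : Type*} (v : X → C) :
    IsPosKernel fun x y : X => s ∘ₗ E ∘ₗ LinearMap.mulLeft ℂ (star (v x)) ∘ₗ
      LinearMap.mulRight ℂ (v y) := by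
  intro t g
  obtain ⟨b, hb⟩ := hE.positive (∑ x ∈ t, g x * v x)
  have h := hs b
  rw [← hb] at h
  convert h using 1
  simp only [star_sum, Finset.sum_mul_sum, map_sum, LinearMap.comp_apply, LinearMap.mulLeft_apply,
    LinearMap.mulRight_apply, star_mul, mul_assoc]

namespace IsReducedAmalgProd

variable (h : IsReducedAmalgProd B jB φ jC emb E)
include h

lemma emb_eq_letter_add_base (i : I) (a : A i) :
    emb i a = emb i (a - jB i (φ i a)) + jC (φ i a) := by
  simp [h.emb_base]

lemma amalgWord_letter (hφ : ∀ i, IsCondExp (jB i) (φ i)) {i : I} {a : A i} (ha : φ i a = 0) :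
    AmalgWord φ jC emb 1 (some i) (emb i a) := by
  have := AltWord.cons (base := Set.range jC) (letter := fun i => emb i '' {a | φ i a = 0})
    ⟨a, ha, rfl⟩ (.base (isLetterSystem_amalg hφ h).one_mem) (by simp)
  rwa [mul_one] at this

lemma condExp_emb_mul_word_mul_emb (hφ : ∀ i, IsCondExp (jB i) (φ i)) {i : I} (a c : A i) {n : ℕ}
    {o : Option I} {z : C} (hz : AmalgWord φ jC emb n o z) (hn : n ≠ 0) (ho : o ≠ some i) :
    E (emb i a * (z * emb i c)) = 0 := by
  have hL := isLetterSystem_amalg hφ h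
  have key {p q : ℕ} {o₁ o₂ : Option I} {u x : C} (hu : AmalgWord φ jC emb p o₁ u)
      (hx : AmalgWord φ jC emb q o₂ x) (ho₁ : o₁ ≠ o ∨ o₁ = none) (hpq : n + p ≠ q) :
      E (star u * (z * x)) = 0 := by
    obtain ⟨o', h'⟩ := hz.star_mul hL hu (by rintro j rfl; rcases ho₁ with h | rfl <;> simp_all)
    have := h.condExp_star_mul_of_length_ne hφ h' hx hpq
    simpa [mul_assoc] using this
  have hle (a : A i) : AmalgWord φ jC emb 1 (some i) (emb i (a - jB i (φ i a))) :=
    h.amalgWord_letter hφ ((hφ i).centered a)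
  have hb (b : B) : AmalgWord φ jC emb 0 none (jC b) := .base ⟨b, rfl⟩
  rw [← star_star a, StarHomClass.map_star (emb i), h.emb_eq_letter_add_base i (star a),
    h.emb_eq_letter_add_base i c]
  simp only [star_add, mul_add, add_mul, map_add]
  rw [key (hle _) (hle _) (.inl (Ne.symm ho)) (by omega), key (hle _) (hb _) (.inl (Ne.symm ho)) (by omega),
    key (hb _) (hb _) (.inr rfl) (by omega)]
  simp only [add_zero, zero_add]
  by_cases hn1 : n = 1
  · subst hn1
    cases hz with
    | @cons j l y n o hl hy ho' =>
      cases hy with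
      | base hb' =>
        have h2 : AmalgWord φ jC emb 2 (some j) (l * _) :=
          .cons hl ((hle c).base_mul hL hb') (by simpa [eq_comm] using ho)
        rw [← StarHomClass.map_star jC, mul_assoc]
        exact h.condExp_word hφ (h2.base_mul hL ⟨_, rfl⟩) (by simp)
  · exact key (hb _) (hle _) (.inr rfl) (by omega)

/-- The conditional expectation from the free product onto one of its factors. -/
lemma exists_letterExpectation (hφ : ∀ i, IsCondExp (jB i) (φ i)) (i : I)
    (hf : FaithfulGNS (φ i)) : ∃ P : C →ₗ[ℂ] A i, IsCompletelyPositive P ∧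
      (∀ a, P (emb i a) = a) ∧ ∀ a n o z, AmalgWord φ jC emb n o z → n ≠ 0 → o ≠ some i →
        P (emb i a * z) = 0 := by
  have hL := isLetterSystem_amalg hφ h
  let S : Set (C × A i) := Set.range (fun a => (emb i a, a)) ∪
    {p | ∃ a n o z, AmalgWord φ jC emb n o z ∧ n ≠ 0 ∧ o ≠ some i ∧ p = (emb i a * z, 0)}
  have hmem (a n o z) (hz : AmalgWord φ jC emb n o z) (hn : n ≠ 0) (ho : o ≠ some i) :
      (emb i a * z, (0 : A i)) ∈ Submodule.span ℂ S :=
    Submodule.subset_span (.inr ⟨a, n, o, z, hz, hn, ho, rfl⟩)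
  have hmem' (a) : (emb i a, a) ∈ Submodule.span ℂ S := Submodule.subset_span (.inl ⟨a, rfl⟩)
  have hR : Dense (Prod.fst '' (Submodule.span ℂ S : Set (C × A i))) := by
    refine (h.dense_span_words hφ).mono ?_
    change _ ⊆ (((Submodule.span ℂ S).map (LinearMap.fst ℂ C (A i)) : Submodule ℂ C) : Set C)
    refine Submodule.span_le.mpr ?_
    rintro z ⟨n, o, hz⟩
    by_cases ho : o = some i
    · cases hz with
      | base => simp at ho
      | @cons j l y n o hl hy ho' =>
        obtain rfl : j = i := by simpa using ho
        obtain ⟨a, ha, rfl⟩ := hl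
        cases hy with
        | base hb =>
          obtain ⟨b, rfl⟩ := hb
          exact ⟨_, hmem' (a * jB j b), by simp [h.emb_base]⟩
        | cons hl' hy' ho'' => exact ⟨_, hmem a _ _ _ (.cons hl' hy' ho'') (by simp) ho', rfl⟩
    · cases hz with
      | base hb =>
        obtain ⟨b, rfl⟩ := hb
        exact ⟨_, hmem' (jB i b), by simp [h.emb_base]⟩
      | cons hl hy ho' => exact ⟨_, hmem 1 _ _ _ (.cons hl hy ho') (by simp) ho, by simp⟩
  obtain ⟨P, hP, hPR, -⟩ := exists_isCompletelyPositive_extension (hφ i) hf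
    (id : A i → A i) (by simp) (Submodule.span ℂ S) hR (by simpa using hmem' 1) fun s hs T => by
    refine ⟨_, h.condExp.isPosKernel (s := (s : B →ₗ[ℂ] ℂ)) hs (fun x : A i => emb i x),
      fun x _ x' _ p hp => ?_⟩
    simp only [LinearMap.comp_apply, LinearMap.mulLeft_apply, LinearMap.mulRight_apply, id]
    induction hp using Submodule.span_induction with
    | mem p hp =>
      rcases hp with ⟨a, rfl⟩ | ⟨a, n, o, z, hz, hn, ho, rfl⟩
      · simp only [← StarHomClass.map_star (emb i), ← map_mul (emb i), h.restrict, mul_assoc]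
        rfl
      · have := h.condExp_emb_mul_word_mul_emb hφ (star x * a) x' hz hn ho
        simp only [map_mul (emb i), StarHomClass.map_star (emb i), mul_assoc] at this
        simp [mul_assoc, this]
    | zero => simp
    | add p q _ _ hp hq => simp only [Prod.fst_add, Prod.snd_add, add_mul, mul_add, map_add, hp, hq]
    | smul r p _ hp =>
      simp only [Prod.smul_fst, Prod.smul_snd, smul_mul_assoc, mul_smul_comm, map_smul, hp]
  exact ⟨P, hP, fun a => hPR _ (hmem' a), fun a n o z hz hn ho => hPR _ (hmem a n o z hz hn ho)⟩

end IsReducedAmalgProd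

end LetterExpectation

/-- Unital completely positive `B`-bimodule maps between the factors of two reduced amalgamated
free products, compatible with the conditional expectations. -/
structure IsAmalgMapFamily {I B : Type*} [CStarAlgebra B]
    {A D : I → Type*} [∀ i, CStarAlgebra (A i)] [∀ i, CStarAlgebra (D i)]
    (jA : ∀ i, B →⋆ₐ[ℂ] A i) (jD : ∀ i, B →⋆ₐ[ℂ] D i)
    (φ : ∀ i, A i →ₗ[ℂ] B) (ψ : ∀ i, D i →ₗ[ℂ] B) (θ : ∀ i, A i →ₗ[ℂ] D i)
    {CA CD : Type*} [CStarAlgebra CA] [CStarAlgebra CD]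
    (jCA : B →⋆ₐ[ℂ] CA) (embA : ∀ i, A i →⋆ₐ[ℂ] CA) (EA : CA →ₗ[ℂ] B)
    (jCD : B →⋆ₐ[ℂ] CD) (embD : ∀ i, D i →⋆ₐ[ℂ] CD) (ED : CD →ₗ[ℂ] B) : Prop where
  condExpA : ∀ i, IsCondExp (jA i) (φ i)
  condExpD : ∀ i, IsCondExp (jD i) (ψ i)
  faithfulA : ∀ i, FaithfulGNS (φ i)
  cp : ∀ i, IsCompletelyPositive (θ i)
  map_one : ∀ i, θ i 1 = 1
  bimodule : ∀ i (b₁ b₂ : B) (a : A i), θ i (jA i b₁ * a * jA i b₂) = jD i b₁ * θ i a * jD i b₂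
  expect : ∀ i (a : A i), ψ i (θ i a) = φ i a
  prodA : IsReducedAmalgProd B jA φ jCA embA EA
  prodD : IsReducedAmalgProd B jD ψ jCD embD ED

/-- Pairs of words in two free products, the letters of the second being the images of the letters
of the first. -/
abbrev PairWord {I B : Type*} [CStarAlgebra B]
    {A D : I → Type*} [∀ i, CStarAlgebra (A i)] [∀ i, CStarAlgebra (D i)]
    (φ : ∀ i, A i →ₗ[ℂ] B) (θ : ∀ i, A i →ₗ[ℂ] D i)
    {CA CD : Type*} [CStarAlgebra CA] [CStarAlgebra CD]
    (jCA : B →⋆ₐ[ℂ] CA) (embA : ∀ i, A i →⋆ₐ[ℂ] CA)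
    (jCD : B →⋆ₐ[ℂ] CD) (embD : ∀ i, D i →⋆ₐ[ℂ] CD) : ℕ → Option I → CA × CD → Prop :=
  AltWord (Set.range fun b => (jCA b, jCD b))
    fun i => (fun a => (embA i a, embD i (θ i a))) '' {a | φ i a = 0}

/-- The span of the pairs of words. -/
def pairSpan {I B : Type*} [CStarAlgebra B]
    {A D : I → Type*} [∀ i, CStarAlgebra (A i)] [∀ i, CStarAlgebra (D i)]
    (φ : ∀ i, A i →ₗ[ℂ] B) (θ : ∀ i, A i →ₗ[ℂ] D i)
    {CA CD : Type*} [CStarAlgebra CA] [CStarAlgebra CD]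
    (jCA : B →⋆ₐ[ℂ] CA) (embA : ∀ i, A i →⋆ₐ[ℂ] CA)
    (jCD : B →⋆ₐ[ℂ] CD) (embD : ∀ i, D i →⋆ₐ[ℂ] CD) : Submodule ℂ (CA × CD) :=
  Submodule.span ℂ {p | ∃ n o, PairWord φ θ jCA embA jCD embD n o p}

namespace IsAmalgMapFamily

variable {I B : Type*} [CStarAlgebra B]
    {A D : I → Type*} [∀ i, CStarAlgebra (A i)] [∀ i, CStarAlgebra (D i)]
    {jA : ∀ i, B →⋆ₐ[ℂ] A i} {jD : ∀ i, B →⋆ₐ[ℂ] D i}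
    {φ : ∀ i, A i →ₗ[ℂ] B} {ψ : ∀ i, D i →ₗ[ℂ] B} {θ : ∀ i, A i →ₗ[ℂ] D i}
    {CA CD : Type*} [CStarAlgebra CA] [CStarAlgebra CD]
    {jCA : B →⋆ₐ[ℂ] CA} {embA : ∀ i, A i →⋆ₐ[ℂ] CA} {EA : CA →ₗ[ℂ] B}
    {jCD : B →⋆ₐ[ℂ] CD} {embD : ∀ i, D i →⋆ₐ[ℂ] CD} {ED : CD →ₗ[ℂ] B}
    (H : IsAmalgMapFamily jA jD φ ψ θ jCA embA EA jCD embD ED)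
include H

lemma map_base_mul (i : I) (b : B) (a : A i) : θ i (jA i b * a) = jD i b * θ i a := by
  simpa using H.bimodule i b 1 a

lemma map_mul_base (i : I) (b : B) (a : A i) : θ i (a * jA i b) = θ i a * jD i b := by
  simpa using H.bimodule i 1 b a

lemma map_base (i : I) (b : B) : θ i (jA i b) = jD i b := by
  simpa [H.map_one] using H.map_mul_base i b 1

lemma isLetterSystem_pair : IsLetterSystem (Set.range fun b => (jCA b, jCD b))
    fun i => (fun a => (embA i a, embD i (θ i a))) '' {a | φ i a = 0} where
  one_mem := ⟨1, by simp⟩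
  mul_mem := by rintro _ _ ⟨b, rfl⟩ ⟨b', rfl⟩; exact ⟨b * b', by simp⟩
  star_mem := by rintro _ ⟨b, rfl⟩; exact ⟨star b, by simp [StarHomClass.map_star, Prod.ext_iff]⟩
  base_mul_letter := by
    rintro i _ _ ⟨b, rfl⟩ ⟨a, ha, rfl⟩
    refine ⟨jA i b * a, ?_, ?_⟩
    · simp_all [(H.condExpA i).map_left]
    · simp [← H.prodA.compat i, ← H.prodD.compat i, H.map_base_mul]
  letter_mul_base := by
    rintro i _ _ ⟨b, rfl⟩ ⟨a, ha, rfl⟩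
    refine ⟨a * jA i b, ?_, ?_⟩
    · simp_all [(H.condExpA i).map_right]
    · simp [← H.prodA.compat i, ← H.prodD.compat i, H.map_mul_base]
  star_letter := by
    rintro i _ ⟨a, ha, rfl⟩
    refine ⟨star a, ?_, ?_⟩
    · simp_all [(H.condExpA i).map_star]
    · simp [StarHomClass.map_star, (H.cp i).map_star, Prod.ext_iff]

omit H in
lemma _root_.PairWord.fst {n : ℕ} {o : Option I} {p : CA × CD}
    (h : PairWord φ θ jCA embA jCD embD n o p) : AmalgWord φ jCA embA n o p.1 := by
  refine AltWord.map (MulHom.fst CA CD) ?_ ?_ h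
  · rintro _ ⟨b, rfl⟩; exact ⟨b, rfl⟩
  · rintro i _ ⟨a, ha, rfl⟩; exact ⟨a, ha, rfl⟩

lemma pairWord_snd {n : ℕ} {o : Option I} {p : CA × CD}
    (h : PairWord φ θ jCA embA jCD embD n o p) : AmalgWord ψ jCD embD n o p.2 := by
  refine AltWord.map (MulHom.snd CA CD) ?_ ?_ h
  · rintro _ ⟨b, rfl⟩; exact ⟨b, rfl⟩
  · rintro i _ ⟨a, ha, rfl⟩; exact ⟨θ i a, (H.expect i a).trans ha, rfl⟩

omit H in
lemma exists_pairWord {n : ℕ} {o : Option I} {z : CA} (h : AmalgWord φ jCA embA n o z) :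
    ∃ p, PairWord φ θ jCA embA jCD embD n o p ∧ p.1 = z := by
  refine AltWord.lift (MulHom.fst CA CD) ?_ ?_ h
  · rintro _ ⟨b, rfl⟩; exact ⟨_, ⟨b, rfl⟩, rfl⟩
  · rintro i _ ⟨a, ha, rfl⟩; exact ⟨_, ⟨a, ha, rfl⟩, rfl⟩

omit H in
lemma _root_.PairWord.mem_pairSpan {n : ℕ} {o : Option I} {p : CA × CD}
    (h : PairWord φ θ jCA embA jCD embD n o p) : p ∈ pairSpan φ θ jCA embA jCD embD :=
  Submodule.subset_span ⟨n, o, h⟩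

lemma one_mem_pairSpan : (1, 1) ∈ pairSpan φ θ jCA embA jCD embD :=
  PairWord.mem_pairSpan (.base H.isLetterSystem_pair.one_mem)

lemma dense_pairSpan : Dense (Prod.fst '' (pairSpan φ θ jCA embA jCD embD : Set (CA × CD))) := by
  refine (H.prodA.dense_span_words H.condExpA).mono ?_
  change _ ⊆ (((pairSpan φ θ jCA embA jCD embD).map (LinearMap.fst ℂ CA CD) : Submodule ℂ CA) : Set CA)
  refine Submodule.span_le.mpr ?_
  rintro z ⟨n, o, hz⟩
  obtain ⟨p, hp, rfl⟩ := exists_pairWord (θ := θ) (jCD := jCD) (embD := embD) hz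
  exact ⟨p, hp.mem_pairSpan, rfl⟩

lemma condExp_snd_eq {p : CA × CD} (hp : p ∈ pairSpan φ θ jCA embA jCD embD) : ED p.2 = EA p.1 := by
  have : pairSpan φ θ jCA embA jCD embD ≤ LinearMap.eqLocus (ED ∘ₗ LinearMap.snd ℂ CA CD)
      (EA ∘ₗ LinearMap.fst ℂ CA CD) := by
    refine Submodule.span_le.mpr ?_
    rintro p ⟨n, o, hp⟩
    change ED p.2 = EA p.1
    by_cases hn : n = 0
    · cases hp with
      | base hb =>
        obtain ⟨b, rfl⟩ := hb
        simp [H.prodA.condExp.left_inverse, H.prodD.condExp.left_inverse]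
      | cons => simp at hn
    · rw [H.prodA.condExp_word H.condExpA hp.fst hn, H.prodD.condExp_word H.condExpD (H.pairWord_snd hp) hn]
  exact this hp

lemma emb_mul_mem_pairSpan {i : I} (a : A i) {n : ℕ} {o : Option I} {p : CA × CD}
    (hp : PairWord φ θ jCA embA jCD embD n o p) (ho : o ≠ some i) :
    (embA i a * p.1, embD i (θ i a) * p.2) ∈ pairSpan φ θ jCA embA jCD embD := by
  have h1 : PairWord φ θ jCA embA jCD embD (n + 1) (some i)
      ((embA i (a - jA i (φ i a)), embD i (θ i (a - jA i (φ i a)))) * p) :=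
    .cons ⟨_, (H.condExpA i).centered a, rfl⟩ hp ho
  have h2 : PairWord φ θ jCA embA jCD embD n o ((jCA (φ i a), jCD (φ i a)) * p) :=
    hp.base_mul H.isLetterSystem_pair ⟨_, rfl⟩
  convert add_mem h1.mem_pairSpan h2.mem_pairSpan using 1
  simp [Prod.ext_iff, H.prodA.emb_base, H.prodD.emb_base, H.map_base, sub_mul]

lemma emb_mem_pairSpan (i : I) (a : A i) :
    (embA i a, embD i (θ i a)) ∈ pairSpan φ θ jCA embA jCD embD := by
  simpa using H.emb_mul_mem_pairSpan a (.base H.isLetterSystem_pair.one_mem) (by simp)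

lemma star_mem_pairSpan {p : CA × CD} (hp : p ∈ pairSpan φ θ jCA embA jCD embD) :
    star p ∈ pairSpan φ θ jCA embA jCD embD := by
  induction hp using Submodule.span_induction with
  | mem p hp =>
    obtain ⟨n, o, hp⟩ := hp
    obtain ⟨o', h⟩ := hp.star H.isLetterSystem_pair
    exact PairWord.mem_pairSpan h
  | zero => simp
  | add p q _ _ hp hq => rw [star_add]; exact add_mem hp hq
  | smul r p _ hp => rw [star_smul]; exact Submodule.smul_mem _ _ hp

lemma exists_eq_emb_mul (i : I) {n : ℕ} {o : Option I} {p : CA × CD}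
    (hp : PairWord φ θ jCA embA jCD embD n o p) :
    ∃ (a : A i) (q : CA × CD), p = (embA i a * q.1, embD i (θ i a) * q.2) ∧
      (q = 1 ∨ ∃ m o', PairWord φ θ jCA embA jCD embD m o' q ∧ m ≠ 0 ∧ o' ≠ some i) := by
  have base (a : A i) (b : B) : ((embA i a * jCA b, embD i (θ i a) * jCD b) : CA × CD) =
      (embA i (a * jA i b) * (1 : CA × CD).1, embD i (θ i (a * jA i b)) * (1 : CA × CD).2) := by
    simp [H.prodA.emb_base, H.prodD.emb_base, H.map_mul_base]
  by_cases ho : o = some i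
  · cases hp with
    | base => simp at ho
    | @cons j l y n o hl hy ho' =>
      obtain rfl : j = i := by simpa using ho
      obtain ⟨a, ha, rfl⟩ := hl
      cases hy with
      | base hb =>
        obtain ⟨b, rfl⟩ := hb
        exact ⟨_, 1, base a b, .inl rfl⟩
      | cons hl' hy' ho'' =>
        exact ⟨a, _, rfl, .inr ⟨_, _, .cons hl' hy' ho'', by simp, ho'⟩⟩
  · cases hp with
    | base hb =>
      obtain ⟨b, rfl⟩ := hb
      exact ⟨_, 1, by simpa [H.map_one] using base 1 b, .inl rfl⟩
    | cons hl hy ho' => exact ⟨1, _, by simp [H.map_one, Prod.ext_iff],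
        .inr ⟨_, _, .cons hl hy ho', by simp, ho⟩⟩

end IsAmalgMapFamily

namespace IsPosKernel

section

variable {X Y C : Type*} [CStarAlgebra C]

lemma add {k k' : X → X → C →ₗ[ℂ] ℂ} (h : IsPosKernel k) (h' : IsPosKernel k') :
    IsPosKernel fun x y => k x y + k' x y := fun t g => by
  simpa only [LinearMap.add_apply, Finset.sum_add_distrib] using add_nonneg (h t g) (h' t g)

lemma comp {k : Y → Y → C →ₗ[ℂ] ℂ} (h : IsPosKernel k) (f : X → Y) :
    IsPosKernel fun x y => k (f x) (f y) :=
  of_rep h.rep (fun x => h.vec (f x)) fun _ _ _ => (h.inner_vec_rep_vec ..).symm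

/-- The matrix coefficients of a representation. -/
def coeff {H : Type*} [NormedAddCommGroup H] [InnerProductSpace ℂ H] [CompleteSpace H]
    (π : C →⋆ₐ[ℂ] (H →L[ℂ] H)) (ξ η : H) : C →ₗ[ℂ] ℂ where
  toFun z := ⟪ξ, π z η⟫_ℂ
  map_add' z w := by simp
  map_smul' r z := by simp

lemma coeff_apply {H : Type*} [NormedAddCommGroup H] [InnerProductSpace ℂ H] [CompleteSpace H]
    (π : C →⋆ₐ[ℂ] (H →L[ℂ] H)) (ξ η : H) (z : C) : coeff π ξ η z = ⟪ξ, π z η⟫_ℂ := rfl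

lemma exists_extend {k : Y → Y → C →ₗ[ℂ] ℂ} (h : IsPosKernel k) :
    ∃ K : X ⊕ Y → X ⊕ Y → C →ₗ[ℂ] ℂ, IsPosKernel K ∧
      (∀ y y', K (.inr y) (.inr y') = k y y') ∧ (∀ x w, K (.inl x) w = 0) ∧
        ∀ w x, K w (.inl x) = 0 := by
  refine ⟨fun w w' => coeff h.rep (Sum.elim 0 h.vec w) (Sum.elim 0 h.vec w'),
    of_rep h.rep (Sum.elim 0 h.vec) fun _ _ _ => rfl, fun y y' => ?_, fun x w => ?_, fun w x => ?_⟩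
  · ext z
    exact h.inner_vec_rep_vec ..
  · ext z
    simp [coeff_apply]
  · ext z
    simp [coeff_apply]

open Classical in
lemma exists_sigma {I : Type*} {X : I → Type*} {k : ∀ i, X i → X i → C →ₗ[ℂ] ℂ}
    (h : ∀ i, IsPosKernel (k i)) :
    ∃ K : (Σ i, X i) → (Σ i, X i) → C →ₗ[ℂ] ℂ, IsPosKernel K ∧
      (∀ i x y, K ⟨i, x⟩ ⟨i, y⟩ = k i x y) ∧ ∀ i j x y, i ≠ j → K ⟨i, x⟩ ⟨j, y⟩ = 0 := by
  refine ⟨fun p q => if e : q.1 = p.1 then k p.1 p.2 (e ▸ q.2) else 0, fun t g => ?_,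
    fun i x y => by simp, fun i j x y hij => by simp [Ne.symm hij]⟩
  rw [← t.sigma_image_fst_preimage_mk]
  simp only [Finset.sum_sigma]
  refine Finset.sum_nonneg fun i hi => ?_
  refine (h i _ fun x => g ⟨i, x⟩).trans_eq (Finset.sum_congr rfl fun x _ => ?_)
  rw [Finset.sum_eq_single_of_mem i hi]
  · simp
  · intro j _ hj
    simp [hj]

end

section

variable {X C A : Type*} [CStarAlgebra C] [CStarAlgebra A]

lemma of_completelyPositive {B D : Type*} [CStarAlgebra B] [CStarAlgebra D] {θ : A →ₗ[ℂ] D}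
    (hθ : IsCompletelyPositive θ) (emb : D →⋆ₐ[ℂ] C) {j : B →⋆ₐ[ℂ] C} {E : C →ₗ[ℂ] B}
    (hE : IsCondExp j E) {s : B →L[ℂ] ℂ} (hs : ∀ x, 0 ≤ s (star x * x)) (v : X → C) :
    IsPosKernel fun x y => (s : B →ₗ[ℂ] ℂ) ∘ₗ E ∘ₗ LinearMap.mulLeft ℂ (star (v x)) ∘ₗ
      LinearMap.mulRight ℂ (v y) ∘ₗ (emb : D →ₗ[ℂ] C) ∘ₗ θ := by
  intro t g
  obtain ⟨γ, hγ⟩ := hθ.exists_gram_finset t g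
  have : 0 ≤ ∑ r ∈ t, s (E (star (∑ p ∈ t, emb (γ r p) * v p) * ∑ p ∈ t, emb (γ r p) * v p)) :=
    Finset.sum_nonneg fun r _ => hE.functional_nonneg hs _
  refine this.trans_eq ?_
  simp only [star_sum, Finset.sum_mul_sum, map_sum]
  rw [Finset.sum_comm]
  refine Finset.sum_congr rfl fun p hp => ?_
  rw [Finset.sum_comm]
  refine Finset.sum_congr rfl fun q hq => ?_
  simp only [LinearMap.comp_apply, LinearMap.mulLeft_apply, LinearMap.mulRight_apply, hγ p hp q hq,
    star_mul, mul_assoc, map_sum]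
  refine Finset.sum_congr rfl fun r _ => ?_
  simp [StarHomClass.map_star, mul_assoc]

/-- The defect of a contraction intertwining two representations, composed with a completely
positive map. -/
lemma sub_of_contraction {F H : Type*} [NormedAddCommGroup F] [InnerProductSpace ℂ F]
    [CompleteSpace F] [NormedAddCommGroup H] [InnerProductSpace ℂ H] [CompleteSpace H]
    {P : C →ₗ[ℂ] A} (hP : IsCompletelyPositive P) (ρ : A →⋆ₐ[ℂ] (F →L[ℂ] F))
    (π : A →⋆ₐ[ℂ] (H →L[ℂ] H)) (J : F →L[ℂ] H) (hJ : ∀ v, ‖J v‖ ≤ ‖v‖)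
    (hJρ : ∀ a v, J (ρ a v) = π a (J v)) (v : X → F) :
    IsPosKernel fun x y => coeff ρ (v x) (v y) ∘ₗ P - coeff π (J (v x)) (J (v y)) ∘ₗ P := by
  intro t g
  obtain ⟨γ, hγ⟩ := hP.exists_gram_finset t g
  have : 0 ≤ ∑ r ∈ t, (⟪∑ p ∈ t, ρ (γ r p) (v p), ∑ p ∈ t, ρ (γ r p) (v p)⟫_ℂ -
      ⟪J (∑ p ∈ t, ρ (γ r p) (v p)), J (∑ p ∈ t, ρ (γ r p) (v p))⟫_ℂ) := by
    refine Finset.sum_nonneg fun r _ => ?_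
    rw [inner_self_eq_norm_sq_to_K, inner_self_eq_norm_sq_to_K, sub_nonneg]
    norm_cast
    gcongr
    exact hJ _
  refine this.trans_eq ?_
  simp only [map_sum, hJρ, sum_inner, inner_sum, ← Finset.sum_sub_distrib]
  rw [Finset.sum_comm]
  conv_rhs => rw [Finset.sum_comm]
  refine Finset.sum_congr rfl fun q hq => ?_
  rw [Finset.sum_comm]
  refine Finset.sum_congr rfl fun p hp => ?_
  simp only [LinearMap.sub_apply, LinearMap.comp_apply, coeff_apply, hγ p hp q hq, map_sum,
    inner_rep_star_mul, Finset.sum_sub_distrib]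

end

end IsPosKernel

section TestSpan

variable {B : Type*} [CStarAlgebra B] {I : Type*} {A : I → Type*}
    [∀ i, CStarAlgebra (A i)] {jB : ∀ i, B →⋆ₐ[ℂ] A i} {φ : ∀ i, A i →ₗ[ℂ] B}
    {C : Type*} [CStarAlgebra C] {jC : B →⋆ₐ[ℂ] C} {emb : ∀ i, A i →⋆ₐ[ℂ] C}
    {E : C →ₗ[ℂ] B}

/-- The span of the words which do not start with `i` or have at most `n` letters. -/
def testSpan (φ : ∀ i, A i →ₗ[ℂ] B) (jC : B →⋆ₐ[ℂ] C) (emb : ∀ i, A i →⋆ₐ[ℂ] C)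
    (i : I) (n : ℕ) : Submodule ℂ C :=
  Submodule.span ℂ {y | ∃ q o, AmalgWord φ jC emb q o y ∧ (o ≠ some i ∨ q ≤ n)}

lemma wordSpan_le_testSpan {i j : I} (hij : j ≠ i) {n p : ℕ} (hp : p ≤ n + 1) :
    wordSpan φ jC emb j p ≤ testSpan φ jC emb i n := by
  refine Submodule.span_mono ?_
  rintro y ⟨q, o, hy, ho⟩
  refine ⟨q, o, hy, ho.imp ?_ (by omega)⟩
  rintro rfl
  simpa using hij

lemma IsReducedAmalgProd.word_mul_mem_testSpan (h : IsReducedAmalgProd B jB φ jC emb E)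
    (hφ : ∀ i, IsCondExp (jB i) (φ i)) {i : I} {m p n : ℕ} {o o' : Option I} {ζ x : C}
    (hζ : AmalgWord φ jC emb m o ζ) (hm : m ≠ 0) (ho : o ≠ some i)
    (hx : AmalgWord φ jC emb p o' x) (hp : p ≤ n + 1) : ζ * x ∈ testSpan φ jC emb i n := by
  obtain _ | j := o
  · exact absurd (hζ.eq_zero_iff.mpr rfl) hm
  · exact wordSpan_le_testSpan (by simpa using ho) hp (h.word_mul_mem_wordSpan hφ hζ rfl hx)

lemma IsReducedAmalgProd.condExp_star_mul_emb_mul_eq_zero (h : IsReducedAmalgProd B jB φ jC emb E)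
    (hφ : ∀ i, IsCondExp (jB i) (φ i)) {n m : ℕ} {o o' : Option I}
    {u x : C} (hu : AmalgWord φ jC emb n o u) (hx : AmalgWord φ jC emb m o' x) {i : I}
    (ho : o ≠ some i) (ho' : o' ≠ some i) (e : A i) (hnm : n ≠ m) :
    E (star u * (emb i e * x)) = 0 := by
  rw [h.condExp_star_mul_emb_mul hφ hu hx ho ho']
  exact h.condExp_star_mul_of_length_ne hφ hu
    (hx.base_mul (isLetterSystem_amalg hφ h) ⟨_, rfl⟩) hnm

end TestSpan

namespace IsAmalgMapFamily

variable {I B : Type*} [CStarAlgebra B]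
    {A D : I → Type*} [∀ i, CStarAlgebra (A i)] [∀ i, CStarAlgebra (D i)]
    {jA : ∀ i, B →⋆ₐ[ℂ] A i} {jD : ∀ i, B →⋆ₐ[ℂ] D i}
    {φ : ∀ i, A i →ₗ[ℂ] B} {ψ : ∀ i, D i →ₗ[ℂ] B} {θ : ∀ i, A i →ₗ[ℂ] D i}
    {CA CD : Type*} [CStarAlgebra CA] [CStarAlgebra CD]
    {jCA : B →⋆ₐ[ℂ] CA} {embA : ∀ i, A i →⋆ₐ[ℂ] CA} {EA : CA →ₗ[ℂ] B}
    {jCD : B →⋆ₐ[ℂ] CD} {embD : ∀ i, D i →⋆ₐ[ℂ] CD} {ED : CD →ₗ[ℂ] B}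
    (H : IsAmalgMapFamily jA jD φ ψ θ jCA embA EA jCD embD ED)
    {s : B →L[ℂ] ℂ} (hs : ∀ x, 0 ≤ s (star x * x))

/-- A kernel whose values at words with at most `n` letters are the matrix coefficients
prescribed by the pairs of words. -/
def IsLevelKernel (φ : ∀ i, A i →ₗ[ℂ] B) (ψ : ∀ i, D i →ₗ[ℂ] B) (θ : ∀ i, A i →ₗ[ℂ] D i)
    (jCA : B →⋆ₐ[ℂ] CA) (embA : ∀ i, A i →⋆ₐ[ℂ] CA)
    (jCD : B →⋆ₐ[ℂ] CD) (embD : ∀ i, D i →⋆ₐ[ℂ] CD) (ED : CD →ₗ[ℂ] B) (s : B →L[ℂ] ℂ)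
    (n : ℕ) (k : CD → CD → CA →ₗ[ℂ] ℂ) : Prop :=
  ∀ x x', (∃ m o, m ≤ n ∧ AmalgWord ψ jCD embD m o x) →
    (∃ m o, m ≤ n ∧ AmalgWord ψ jCD embD m o x') →
      ∀ p ∈ pairSpan φ θ jCA embA jCD embD, k x x' p.1 = s (ED (star x * (p.2 * x')))

include H hs

lemma exists_levelKernel_zero :
    ∃ k, IsPosKernel k ∧ IsLevelKernel φ ψ θ jCA embA jCD embD ED s 0 k := by
  refine ⟨_, H.prodA.condExp.isPosKernel (s := (s : B →ₗ[ℂ] ℂ)) hs fun x => jCA (ED x), ?_⟩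
  rintro x x' ⟨m, o, hm, hx⟩ ⟨m', o', hm', hx'⟩ p hp
  cases hx with
  | cons => simp at hm
  | base hb =>
    cases hx' with
    | cons => simp at hm'
    | base hb' =>
      obtain ⟨b, rfl⟩ := hb
      obtain ⟨b', rfl⟩ := hb'
      simp [← StarHomClass.map_star jCA, ← StarHomClass.map_star jCD,
        H.prodA.condExp.map_left, H.prodA.condExp.map_right,
        H.prodD.condExp.map_left, H.prodD.condExp.map_right, H.prodD.condExp.left_inverse,
        H.condExp_snd_eq hp]

omit hs in
lemma exists_test_vector {n : ℕ} {i : I} {F : Type*} [NormedAddCommGroup F] [InnerProductSpace ℂ F]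
    [CompleteSpace F] {ρ : A i →⋆ₐ[ℂ] (F →L[ℂ] F)}
    {v : D i × {y // ∃ o, AmalgWord ψ jCD embD n o y ∧ o ≠ some i} → F}
    (hv : ∀ p p' a, ⟪v p, ρ a (v p')⟫_ℂ =
      s (ED (star (embD i p.1 * p.2.1) * (embD i (θ i a) * (embD i p'.1 * p'.2.1)))))
    (a : A i) {x : CD} (hx : x ∈ testSpan ψ jCD embD i n) :
    ∃ τ ∈ (Submodule.span ℂ (Set.range
        fun y : A i × {y // ∃ o, AmalgWord ψ jCD embD n o y ∧ o ≠ some i} =>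
        ρ y.1 (v (1, y.2)))).topologicalClosure,
      ∀ (f : A i) p, ⟪ρ f (v p), τ⟫_ℂ =
        s (ED (star (embD i p.1 * p.2.1) * (embD i (θ i (star f * a)) * x))) := by
  induction hx using Submodule.span_induction with
  | zero => exact ⟨0, zero_mem _, by simp⟩
  | add x y _ _ hx hy =>
    obtain ⟨τ, hτ, h1⟩ := hx
    obtain ⟨τ', hτ', h2⟩ := hy
    exact ⟨τ + τ', add_mem hτ hτ', fun f p => by simp [h1, h2, mul_add]⟩
  | smul r x _ hx =>
    obtain ⟨τ, hτ, h1⟩ := hx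
    exact ⟨r • τ, Submodule.smul_mem _ _ hτ, fun f p => by simp [h1]⟩
  | mem x hx =>
    obtain ⟨q, o, hx, ho⟩ := hx
    have zero {q : ℕ} {o : Option I} {x : CD} (hx : AmalgWord ψ jCD embD q o x)
        (ho : o ≠ some i) (hq : q ≠ n) (c : D i)
        (p : D i × {y // ∃ o, AmalgWord ψ jCD embD n o y ∧ o ≠ some i}) :
        ED (star (embD i p.1 * p.2.1) * (embD i c * x)) = 0 := by
      obtain ⟨o', hy, ho'⟩ := p.2.2
      have := H.prodD.condExp_star_mul_emb_mul_eq_zero H.condExpD hy hx ho' ho (star p.1 * c) hq.symm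
      rw [← this, map_mul (embD i), StarHomClass.map_star (embD i), star_mul]
      simp only [mul_assoc]
    by_cases ho' : o = some i
    · refine ⟨0, zero_mem _, fun f p => ?_⟩
      cases hx with
      | base => simp at ho'
      | @cons j l y m o hl hy ho'' =>
        obtain rfl : j = i := by simpa using ho'
        obtain ⟨c, hc, rfl⟩ := hl
        have := zero hy ho'' (by have := ho.resolve_left (by simp); omega) (θ j (star f * a) * c) p
        rw [map_mul (embD j), mul_assoc] at this
        rw [this, map_zero, inner_zero_right]
    · by_cases hq : q = n
      · subst hq
        refine ⟨ρ a (v (1, ⟨x, o, hx, ho'⟩)), Submodule.le_topologicalClosure _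
          (Submodule.subset_span ⟨(a, ⟨x, o, hx, ho'⟩), rfl⟩), fun f p => ?_⟩
        rw [← inner_rep_star_mul, hv]
        simp
      · exact ⟨0, zero_mem _, fun f p => by rw [zero hx ho' hq, map_zero, inner_zero_right]⟩

/-- The vectors and the defect kernels which extend a kernel to words with one more letter. -/
lemma exists_defect {n : ℕ} {k : CD → CD → CA →ₗ[ℂ] ℂ} (h : IsPosKernel k)
    (hk : IsLevelKernel φ ψ θ jCA embA jCD embD ED s n k) (i : I) :
    ∃ (η : D i × {y // ∃ o, AmalgWord ψ jCD embD n o y ∧ o ≠ some i} → h.Space)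
      (δ : D i × {y // ∃ o, AmalgWord ψ jCD embD n o y ∧ o ≠ some i} →
        D i × {y // ∃ o, AmalgWord ψ jCD embD n o y ∧ o ≠ some i} → CA →ₗ[ℂ] ℂ),
      IsPosKernel δ ∧
      (∀ ξ : h.Space, ∀ a : A i, ∀ x ∈ testSpan ψ jCD embD i n,
        (∀ (f : A i) (u : {y // ∃ o, AmalgWord ψ jCD embD n o y ∧ o ≠ some i}),
          ⟪h.rep (embA i f) (h.vec u), ξ⟫_ℂ =
            s (ED (star u.1 * (embD i (θ i (star f * a)) * x)))) →
        ∀ p, ⟪η p, ξ⟫_ℂ = s (ED (star (embD i p.1 * p.2.1) * (embD i (θ i a) * x)))) ∧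
      (∀ p p' a, δ p p' (embA i a) + ⟪η p, h.rep (embA i a) (η p')⟫_ℂ =
        s (ED (star (embD i p.1 * p.2.1) * (embD i (θ i a) * (embD i p'.1 * p'.2.1))))) ∧
      ∀ p p' a m o z, AmalgWord φ jCA embA m o z → m ≠ 0 → o ≠ some i →
        δ p p' (embA i a * z) = 0 := by
  set Y := {y // ∃ o, AmalgWord ψ jCD embD n o y ∧ o ≠ some i}
  obtain ⟨P, hP, hPemb, hPz⟩ := H.prodA.exists_letterExpectation H.condExpA i (H.faithfulA i)
  have hF := IsPosKernel.of_completelyPositive (H.cp i) (embD i) H.prodD.condExp hs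
    (fun p : D i × Y => embD i p.1 * p.2.1)
  have hFv (p p' : D i × Y) (a : A i) : ⟪hF.vec p, hF.rep a (hF.vec p')⟫_ℂ =
      s (ED (star (embD i p.1 * p.2.1) * (embD i (θ i a) * (embD i p'.1 * p'.2.1)))) :=
    hF.inner_vec_rep_vec ..
  let e : A i × Y → hF.Space := fun y => hF.rep y.1 (hF.vec (1, y.2))
  let g : A i × Y → h.Space := fun y => h.rep (embA i y.1) (h.vec y.2)
  have hY (u : Y) : ∃ m o, m ≤ n ∧ AmalgWord ψ jCD embD m o u.1 := by
    obtain ⟨o, ho, -⟩ := u.2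
    exact ⟨n, o, le_rfl, ho⟩
  have heg (y y') : ⟪e y, e y'⟫_ℂ = ⟪g y, g y'⟫_ℂ := by
    rw [← inner_rep_star_mul, hFv, ← inner_rep_star_mul, h.inner_vec_rep_vec,
      ← StarHomClass.map_star (embA i), ← map_mul (embA i),
      hk _ _ (hY _) (hY _) _ (H.emb_mem_pairSpan i _)]
    simp
  obtain ⟨J, hJ, hJe, hJ0, hJξ⟩ := exists_partialIsometry e g heg
  have hJρ (a : A i) (v) : J (hF.rep a v) = (h.rep.comp (embA i)) a (J v) := by
    refine partialIsometry_intertwines hJe hJ0 (fun a y => ⟨(a * y.1, y.2), ?_, ?_⟩) a v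
    · simp [e]
    · simp [g]
  refine ⟨fun p => J (hF.vec p), _,
    IsPosKernel.sub_of_contraction hP hF.rep (h.rep.comp (embA i)) J hJ hJρ hF.vec, ?_, ?_, ?_⟩
  · intro ξ a x hx hξ p
    obtain ⟨τ, hτ, h1⟩ := H.exists_test_vector hFv a hx
    rw [hJξ ξ τ hτ fun y => ?_]
    · simpa using h1 1 p
    · rw [hξ, h1]
      simp
  · intro p p' a
    simp [IsPosKernel.coeff_apply, hPemb, hFv]
  · intro p p' a m o z hz hm ho
    simp [hPz a m o z hz hm ho]

end IsAmalgMapFamily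

namespace IsAmalgMapFamily

variable {I B : Type*} [CStarAlgebra B]
    {A D : I → Type*} [∀ i, CStarAlgebra (A i)] [∀ i, CStarAlgebra (D i)]
    {jA : ∀ i, B →⋆ₐ[ℂ] A i} {jD : ∀ i, B →⋆ₐ[ℂ] D i}
    {φ : ∀ i, A i →ₗ[ℂ] B} {ψ : ∀ i, D i →ₗ[ℂ] B} {θ : ∀ i, A i →ₗ[ℂ] D i}
    {CA CD : Type*} [CStarAlgebra CA] [CStarAlgebra CD]
    {jCA : B →⋆ₐ[ℂ] CA} {embA : ∀ i, A i →⋆ₐ[ℂ] CA} {EA : CA →ₗ[ℂ] B}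
    {jCD : B →⋆ₐ[ℂ] CD} {embD : ∀ i, D i →⋆ₐ[ℂ] CD} {ED : CD →ₗ[ℂ] B}
    (H : IsAmalgMapFamily jA jD φ ψ θ jCA embA EA jCD embD ED)
    {s : B →L[ℂ] ℂ} (hs : ∀ x, 0 ≤ s (star x * x))
    {n : ℕ} {k : CD → CD → CA →ₗ[ℂ] ℂ} (h : IsPosKernel k)
    (hk : IsLevelKernel φ ψ θ jCA embA jCD embD ED s n k)
include H hk

lemma inner_defect_vec {i : I}
    {η : D i × {y // ∃ o, AmalgWord ψ jCD embD n o y ∧ o ≠ some i} → h.Space}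
    (hη : ∀ ξ : h.Space, ∀ a : A i, ∀ x ∈ testSpan ψ jCD embD i n,
        (∀ (f : A i) (u : {y // ∃ o, AmalgWord ψ jCD embD n o y ∧ o ≠ some i}),
          ⟪h.rep (embA i f) (h.vec u), ξ⟫_ℂ =
            s (ED (star u.1 * (embD i (θ i (star f * a)) * x)))) →
        ∀ p, ⟪η p, ξ⟫_ℂ = s (ED (star (embD i p.1 * p.2.1) * (embD i (θ i a) * x))))
    (p : D i × {y // ∃ o, AmalgWord ψ jCD embD n o y ∧ o ≠ some i}) {x : CD} {m : ℕ} (hm : m ≤ n)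
    {o : Option I} (hx : AmalgWord ψ jCD embD m o x) {r : CA × CD}
    (hr : r ∈ pairSpan φ θ jCA embA jCD embD) :
    ⟪η p, h.rep r.1 (h.vec x)⟫_ℂ = s (ED (star (embD i p.1 * p.2.1) * (r.2 * x))) := by
  induction hr using Submodule.span_induction with
  | zero => simp
  | add r r' _ _ hr hr' =>
    simp only [Prod.fst_add, Prod.snd_add, add_mul, mul_add, map_add, hr, hr',
      add_apply, inner_add_right]
  | smul c r _ hr =>
    simp only [Prod.smul_fst, Prod.smul_snd, smul_mul_assoc, mul_smul_comm, map_smul, hr,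
      smul_apply, inner_smul_right, smul_eq_mul]
  | mem r hr =>
    obtain ⟨l, o', hr⟩ := hr
    obtain ⟨a, q, rfl, hq⟩ := H.exists_eq_emb_mul i hr
    have hmem : q.2 * x ∈ testSpan ψ jCD embD i n := by
      rcases hq with rfl | ⟨l', o'', hq, hl', ho''⟩
      · rw [Prod.snd_one, one_mul]
        exact Submodule.subset_span ⟨m, o, hx, .inr hm⟩
      · exact H.prodD.word_mul_mem_testSpan H.condExpD (H.pairWord_snd hq) hl' ho'' hx (by omega)
    have hR (c : A i) : (embA i c * q.1, embD i (θ i c) * q.2) ∈ pairSpan φ θ jCA embA jCD embD := by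
      rcases hq with rfl | ⟨l', o'', hq, hl', ho''⟩
      · simpa using H.emb_mem_pairSpan i c
      · exact H.emb_mul_mem_pairSpan c hq ho''
    rw [hη _ a _ hmem, mul_assoc]
    intro f u
    obtain ⟨u, o', hu, ho'⟩ := u
    rw [← inner_rep_star_mul, h.inner_vec_rep_vec, ← mul_assoc, ← StarHomClass.map_star (embA i),
      ← map_mul (embA i), hk _ _ ⟨n, o', le_rfl, hu⟩ ⟨m, o, hm, hx⟩ _ (hR _), mul_assoc]

include hs

lemma inner_vec_defect {i : I}
    {η : D i × {y // ∃ o, AmalgWord ψ jCD embD n o y ∧ o ≠ some i} → h.Space}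
    (hη : ∀ ξ : h.Space, ∀ a : A i, ∀ x ∈ testSpan ψ jCD embD i n,
        (∀ (f : A i) (u : {y // ∃ o, AmalgWord ψ jCD embD n o y ∧ o ≠ some i}),
          ⟪h.rep (embA i f) (h.vec u), ξ⟫_ℂ =
            s (ED (star u.1 * (embD i (θ i (star f * a)) * x)))) →
        ∀ p, ⟪η p, ξ⟫_ℂ = s (ED (star (embD i p.1 * p.2.1) * (embD i (θ i a) * x))))
    (p : D i × {y // ∃ o, AmalgWord ψ jCD embD n o y ∧ o ≠ some i}) {x : CD} {m : ℕ} (hm : m ≤ n)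
    {o : Option I} (hx : AmalgWord ψ jCD embD m o x) {r : CA × CD}
    (hr : r ∈ pairSpan φ θ jCA embA jCD embD) :
    ⟪h.vec x, h.rep r.1 (η p)⟫_ℂ = s (ED (star x * (r.2 * (embD i p.1 * p.2.1)))) := by
  have h1 := H.inner_defect_vec h hk hη p hm hx (H.star_mem_pairSpan hr)
  have h2 := positive_functional_star (s := (s : B →ₗ[ℂ] ℂ)) hs
    (ED (star x * (r.2 * (embD i p.1 * p.2.1))))
  rw [← H.prodD.condExp.map_star] at h2
  rw [← star_star r.1, inner_rep_star, ← inner_conj_symm, ← Prod.fst_star, h1, starRingEnd_apply,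
    star_eq_iff_star_eq]
  refine h2.symm.trans ?_
  simp [mul_assoc]

lemma inner_defect_defect {i i' : I}
    {η : D i × {y // ∃ o, AmalgWord ψ jCD embD n o y ∧ o ≠ some i} → h.Space}
    {η' : D i' × {y // ∃ o, AmalgWord ψ jCD embD n o y ∧ o ≠ some i'} → h.Space}
    (hη : ∀ ξ : h.Space, ∀ a : A i, ∀ x ∈ testSpan ψ jCD embD i n,
        (∀ (f : A i) (u : {y // ∃ o, AmalgWord ψ jCD embD n o y ∧ o ≠ some i}),
          ⟪h.rep (embA i f) (h.vec u), ξ⟫_ℂ =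
            s (ED (star u.1 * (embD i (θ i (star f * a)) * x)))) →
        ∀ p, ⟪η p, ξ⟫_ℂ = s (ED (star (embD i p.1 * p.2.1) * (embD i (θ i a) * x))))
    (hη' : ∀ ξ : h.Space, ∀ a : A i', ∀ x ∈ testSpan ψ jCD embD i' n,
        (∀ (f : A i') (u : {y // ∃ o, AmalgWord ψ jCD embD n o y ∧ o ≠ some i'}),
          ⟪h.rep (embA i' f) (h.vec u), ξ⟫_ℂ =
            s (ED (star u.1 * (embD i' (θ i' (star f * a)) * x)))) →
        ∀ p, ⟪η' p, ξ⟫_ℂ = s (ED (star (embD i' p.1 * p.2.1) * (embD i' (θ i' a) * x))))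
    (p : D i × {y // ∃ o, AmalgWord ψ jCD embD n o y ∧ o ≠ some i})
    (p' : D i' × {y // ∃ o, AmalgWord ψ jCD embD n o y ∧ o ≠ some i'}) (hp' : ψ i' p'.1 = 0)
    (a : A i) {q : CA × CD}
    (hq : (q = 1 ∧ i ≠ i') ∨
      ∃ m o, PairWord φ θ jCA embA jCD embD m o q ∧ m ≠ 0 ∧ o ≠ some i) :
    ⟪η p, h.rep (embA i a * q.1) (η' p')⟫_ℂ =
      s (ED (star (embD i p.1 * p.2.1) * ((embD i (θ i a) * q.2) * (embD i' p'.1 * p'.2.1)))) := by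
  have hw : AmalgWord ψ jCD embD (n + 1) (some i') (embD i' p'.1 * p'.2.1) := by
    obtain ⟨o, ho, ho'⟩ := p'.2.2
    exact .cons ⟨_, hp', rfl⟩ ho ho'
  have hmem : q.2 * (embD i' p'.1 * p'.2.1) ∈ testSpan ψ jCD embD i n := by
    rcases hq with ⟨rfl, hi⟩ | ⟨l', o'', hq, hl', ho''⟩
    · rw [Prod.snd_one, one_mul]
      exact Submodule.subset_span ⟨_, _, hw, .inl (by simpa using hi.symm)⟩
    · exact H.prodD.word_mul_mem_testSpan H.condExpD (H.pairWord_snd hq) hl' ho'' hw le_rfl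
  have hR (c : A i) : (embA i c * q.1, embD i (θ i c) * q.2) ∈ pairSpan φ θ jCA embA jCD embD := by
    rcases hq with ⟨rfl, -⟩ | ⟨l', o'', hq, hl', ho''⟩
    · simpa using H.emb_mem_pairSpan i c
    · exact H.emb_mul_mem_pairSpan c hq ho''
  rw [hη _ a _ hmem, mul_assoc]
  intro f u
  obtain ⟨u, o', hu, ho'⟩ := u
  rw [← inner_rep_star_mul, ← mul_assoc, ← StarHomClass.map_star (embA i),
    ← map_mul (embA i), H.inner_vec_defect hs h hk hη' p' le_rfl hu (hR _), mul_assoc]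

include h in
lemma exists_levelKernel_succ :
    ∃ k', IsPosKernel k' ∧ IsLevelKernel φ ψ θ jCA embA jCD embD ED s (n + 1) k' := by
  choose η δ hδ hη hδemb hδz using H.exists_defect hs h hk
  obtain ⟨K₀, hK₀, hK₀s, hK₀n⟩ := IsPosKernel.exists_sigma hδ
  obtain ⟨K₁, hK₁, hK₁r, hK₁l, hK₁l'⟩ := hK₀.exists_extend (X := CD)
  let W := CD ⊕ Σ i, D i × {y // ∃ o, AmalgWord ψ jCD embD n o y ∧ o ≠ some i}
  let α : W → h.Space := Sum.elim h.vec fun p => η p.1 p.2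
  let val : W → CD := Sum.elim id fun p => embD p.1 p.2.1 * p.2.2.1
  let good : W → Prop := Sum.elim (fun x => ∃ m o, m ≤ n ∧ AmalgWord ψ jCD embD m o x)
    fun p => ψ p.1 p.2.1 = 0
  have hK : IsPosKernel fun w w' => IsPosKernel.coeff h.rep (α w) (α w') + K₁ w w' :=
    .add (.of_rep h.rep α fun _ _ _ => rfl) hK₁
  have key (w w' : W) (hw : good w) (hw' : good w') (r : CA × CD)
      (hr : r ∈ pairSpan φ θ jCA embA jCD embD) :
      ⟪α w, h.rep r.1 (α w')⟫_ℂ + K₁ w w' r.1 = s (ED (star (val w) * (r.2 * val w'))) := by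
    rcases w with x | ⟨i, p⟩
    · rw [hK₁l, LinearMap.zero_apply, add_zero]
      obtain ⟨m, o, hm, hx⟩ := hw
      rcases w' with x' | ⟨i', p'⟩
      · exact (h.inner_vec_rep_vec ..).trans (hk _ _ ⟨m, o, hm, hx⟩ hw' r hr)
      · exact H.inner_vec_defect hs h hk (hη i') p' hm hx hr
    · rcases w' with x' | ⟨i', p'⟩
      · rw [hK₁l', LinearMap.zero_apply, add_zero]
        obtain ⟨m, o, hm, hx⟩ := hw'
        exact H.inner_defect_vec h hk (hη i) p hm hx hr
      · rw [hK₁r]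
        change ⟪η i p, h.rep r.1 (η i' p')⟫_ℂ + _ =
          s (ED (star (embD i p.1 * p.2.1) * (r.2 * (embD i' p'.1 * p'.2.1))))
        induction hr using Submodule.span_induction with
        | zero => simp
        | add r r' _ _ hr hr' =>
          simp only [Prod.fst_add, Prod.snd_add, add_mul, mul_add, map_add, ← hr, ← hr',
            add_apply, inner_add_right]
          ring
        | smul c r _ hr =>
          simp only [Prod.smul_fst, Prod.smul_snd, smul_mul_assoc, mul_smul_comm, map_smul, ← hr,
            smul_apply, inner_smul_right, smul_eq_mul]
          ring
        | mem r hr =>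
          obtain ⟨m, o, hr⟩ := hr
          obtain ⟨a, q, rfl, hq⟩ := H.exists_eq_emb_mul i hr
          have hd := H.inner_defect_defect hs h hk (hη i) (hη i') p p' hw' a (q := q)
          by_cases hi : i = i'
          · subst hi
            rw [hK₀s]
            rcases hq with rfl | ⟨l, o', hq, hl, ho'⟩
            · simpa [add_comm] using hδemb i p p' a
            · rw [hd (.inr ⟨l, o', hq, hl, ho'⟩), hδz i p p' a l o' q.1 hq.fst hl ho', add_zero]
          · rw [hK₀n _ _ _ _ hi, LinearMap.zero_apply, add_zero]
            exact hd (hq.imp_left fun hq => ⟨hq, hi⟩)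
  have hf (x : CD) : ∃ w : W, (∃ m o, m ≤ n + 1 ∧ AmalgWord ψ jCD embD m o x) →
      good w ∧ val w = x := by
    by_cases hx : ∃ m o, m ≤ n + 1 ∧ AmalgWord ψ jCD embD m o x
    · obtain ⟨m, o, hm, hx⟩ := hx
      by_cases hm' : m ≤ n
      · exact ⟨.inl x, fun _ => ⟨⟨m, o, hm', hx⟩, rfl⟩⟩
      · cases hx with
        | base => simp at hm'
        | @cons i l y m o hl hy ho =>
          obtain rfl : m = n := by omega
          obtain ⟨d, hd, rfl⟩ := hl
          exact ⟨.inr ⟨i, d, y, o, hy, ho⟩, fun _ => ⟨hd, rfl⟩⟩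
    · exact ⟨.inl x, fun h => absurd h hx⟩
  choose f hf using hf
  refine ⟨_, hK.comp f, fun x x' hx hx' r hr => ?_⟩
  have := key _ _ (hf x hx).1 (hf x' hx').1 r hr
  rwa [(hf x hx).2, (hf x' hx').2] at this

omit hk in
lemma exists_levelKernel (n : ℕ) :
    ∃ k, IsPosKernel k ∧ IsLevelKernel φ ψ θ jCA embA jCD embD ED s n k := by
  induction n with
  | zero => exact H.exists_levelKernel_zero hs
  | succ n ih =>
    obtain ⟨k, h, hk⟩ := ih
    exact H.exists_levelKernel_succ hs h hk

omit hk hs in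
lemma exists_completelyPositive :
    ∃ Θ : CA →ₗ[ℂ] CD, IsCompletelyPositive Θ ∧
      (∀ p ∈ pairSpan φ θ jCA embA jCD embD, Θ p.1 = p.2) ∧ ∀ z, ‖Θ z‖ ≤ ‖z‖ := by
  refine exists_isCompletelyPositive_extension H.prodD.condExp H.prodD.faithful
    (fun x : {x // ∃ n o, AmalgWord ψ jCD embD n o x} => x.1) ?_ _ H.dense_pairSpan
    H.one_mem_pairSpan fun s hs T => ?_
  · rw [Subtype.range_coe_subtype]
    exact H.prodD.dense_span_words H.condExpD
  · choose l o hl using fun x : {x // ∃ n o, AmalgWord ψ jCD embD n o x} => x.2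
    obtain ⟨k, h, hk⟩ := H.exists_levelKernel hs (T.sup l)
    refine ⟨_, h.comp Subtype.val, fun x hx x' hx' p hp => ?_⟩
    rw [hk x x' ⟨l x, o x, Finset.le_sup hx, hl x⟩ ⟨l x', o x', Finset.le_sup hx', hl x'⟩ p hp,
      mul_assoc]

end IsAmalgMapFamily

lemma PairWord.of_prod {I B : Type*} [CStarAlgebra B]
    {A D : I → Type*} [∀ i, CStarAlgebra (A i)] [∀ i, CStarAlgebra (D i)]
    {φ : ∀ i, A i →ₗ[ℂ] B} {θ : ∀ i, A i →ₗ[ℂ] D i}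
    {CA CD : Type*} [CStarAlgebra CA] [CStarAlgebra CD]
    {jCA : B →⋆ₐ[ℂ] CA} {embA : ∀ i, A i →⋆ₐ[ℂ] CA}
    {jCD : B →⋆ₐ[ℂ] CD} {embD : ∀ i, D i →⋆ₐ[ℂ] CD}
    (n : ℕ) (ι : Fin (n + 1) → I) (hι : ∀ k : Fin n, ι k.castSucc ≠ ι k.succ)
    (a : (j : Fin (n + 1)) → A (ι j)) (ha : ∀ j, φ (ι j) (a j) = 0) :
    PairWord φ θ jCA embA jCD embD (n + 1) (some (ι 0))
      ((List.ofFn fun j => embA (ι j) (a j)).prod,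
        (List.ofFn fun j => embD (ι j) (θ (ι j) (a j))).prod) := by
  induction n with
  | zero =>
    have h₀ : PairWord φ θ jCA embA jCD embD 0 none 1 := .base ⟨1, by simp [Prod.ext_iff]⟩
    have : PairWord φ θ jCA embA jCD embD (0 + 1) (some (ι 0))
        ((embA (ι 0) (a 0), embD (ι 0) (θ (ι 0) (a 0))) * 1) :=
      .cons ⟨a 0, ha 0, rfl⟩ h₀ (by simp)
    simpa using this
  | succ n ih =>
    have h := ih (fun j => ι j.succ) (fun k => hι k.succ) (fun j => a j.succ) fun j => ha j.succ
    rw [List.ofFn_succ (f := fun j => embA (ι j) (a j)),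
      List.ofFn_succ (f := fun j => embD (ι j) (θ (ι j) (a j))), List.prod_cons, List.prod_cons,
      ← Prod.mk_mul_mk]
    refine AltWord.cons ?_ h (by simpa using (hι 0).symm)
    exact ⟨a 0, ha 0, rfl⟩

end

/-- **Theorem (fpcpuBB).**  Let `B` be a unital C⋆-algebra, `I` a set, and for every
`i ∈ I` let `A i` and `D i` be unital C⋆-algebras containing copies of `B` as unital
C⋆-subalgebras (via `jA i`, `jD i`), with conditional expectations `φ i : A i → B` and
`ψ i : D i → B` whose GNS representations are faithful.  Suppose that for each `i ∈ I`
there is a unital completely positive map `θi i : A i → D i` that is also a `B`–`B`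
bimodule map and satisfies `ψ i ∘ θi i = φ i`.  Let
`(CA, EA) = (*_B)_{i ∈ I}(A i, φ i)` and `(CD, ED) = (*_B)_{i ∈ I}(D i, ψ i)` be the
reduced amalgamated free products of C⋆-algebras.  Then there is a unital completely
positive map `θ : CA → CD` such that, for all `i ∈ I`, the restriction of `θ` to the
canonical copy of `A i` in `CA` equals `θi i` followed by the canonical embedding
`D i ↪ CD`, and `ED ∘ θ = EA`; moreover
`θ (a 1 * a 2 * ⋯ * a n) = θ (a 1) * θ (a 2) * ⋯ * θ (a n)` whenever
`a j ∈ A (ι j)` with `φ (ι j) (a j) = 0` and `ι 1 ≠ ι 2, …, ι (n-1) ≠ ι n`. -/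
theorem exists_reducedAmalgProd_ucp_map
    {I : Type*} (B : Type*) [CStarAlgebra B]
    (A D : I → Type*) [∀ i, CStarAlgebra (A i)] [∀ i, CStarAlgebra (D i)]
    (jA : ∀ i, B →⋆ₐ[ℂ] A i) (jD : ∀ i, B →⋆ₐ[ℂ] D i)
    (φ : ∀ i, A i →ₗ[ℂ] B) (ψ : ∀ i, D i →ₗ[ℂ] B)
    (hφ : ∀ i, IsCondExp (jA i) (φ i)) (hψ : ∀ i, IsCondExp (jD i) (ψ i))
    (hφfaith : ∀ i, FaithfulGNS (φ i)) (hψfaith : ∀ i, FaithfulGNS (ψ i))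
    (θi : ∀ i, A i →ₗ[ℂ] D i)
    (hcp : ∀ i, IsCompletelyPositive (θi i)) (hunital : ∀ i, θi i 1 = 1)
    (hbimod : ∀ i (b₁ b₂ : B) (a : A i),
      θi i (jA i b₁ * a * jA i b₂) = jD i b₁ * θi i a * jD i b₂)
    (hcompat : ∀ i (a : A i), ψ i (θi i a) = φ i a)
    {CA : Type*} [CStarAlgebra CA] (jCA : B →⋆ₐ[ℂ] CA) (embA : ∀ i, A i →⋆ₐ[ℂ] CA)
    (EA : CA →ₗ[ℂ] B) (hprodA : IsReducedAmalgProd B jA φ jCA embA EA)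
    {CD : Type*} [CStarAlgebra CD] (jCD : B →⋆ₐ[ℂ] CD) (embD : ∀ i, D i →⋆ₐ[ℂ] CD)
    (ED : CD →ₗ[ℂ] B) (hprodD : IsReducedAmalgProd B jD ψ jCD embD ED) :
    ∃ θ : CA →ₗ[ℂ] CD,
      IsCompletelyPositive θ ∧ θ 1 = 1 ∧
      (∀ i (a : A i), θ (embA i a) = embD i (θi i a)) ∧
      (∀ x : CA, ED (θ x) = EA x) ∧
      (∀ (n : ℕ) (ι : Fin (n + 1) → I), (∀ k : Fin n, ι k.castSucc ≠ ι k.succ) →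
        ∀ a : (j : Fin (n + 1)) → A (ι j), (∀ j, φ (ι j) (a j) = 0) →
          θ ((List.ofFn fun j => embA (ι j) (a j)).prod) =
            (List.ofFn fun j => θ (embA (ι j) (a j))).prod) := by
  have H : IsAmalgMapFamily jA jD φ ψ θi jCA embA EA jCD embD ED :=
    ⟨hφ, hψ, hφfaith, hcp, hunital, hbimod, hcompat, hprodA, hprodD⟩
  obtain ⟨Θ, hΘ, hΘp, hΘn⟩ := H.exists_completelyPositive
  have hemb (i : I) (a : A i) : Θ (embA i a) = embD i (θi i a) := hΘp _ (H.emb_mem_pairSpan i a)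
  refine ⟨Θ, hΘ, hΘp _ H.one_mem_pairSpan, hemb, ?_, fun n ι hι a ha => ?_⟩
  · have hΘc : Continuous Θ := AddMonoidHomClass.continuous_of_bound Θ 1 (by simpa using hΘn)
    have hEA : Continuous EA :=
      AddMonoidHomClass.continuous_of_bound EA 1 (by simpa using hprodA.condExp.contractive)
    have hED : Continuous ED :=
      AddMonoidHomClass.continuous_of_bound ED 1 (by simpa using hprodD.condExp.contractive)
    refine congrFun ((hED.comp hΘc).ext_on H.dense_pairSpan hEA ?_)
    rintro _ ⟨p, hp, rfl⟩
    rw [Function.comp_apply, hΘp p hp, H.condExp_snd_eq hp]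
  · simp only [hemb]
    exact hΘp _ (PairWord.of_prod n ι hι a ha).mem_pairSpan
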